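/- arXiv:2408.07139 — 5 statements merged into one kernel-verified Lean document; each statement's English description precedes it below -/
import Mathlib

section
/- Let N ≥ 2 and let c : {1,…,N−1} → ℝ satisfy c(x) > 0 for all x. Then the operator −Δ^c on functions {1,…,N} → ℝ has exactly N eigenvalues, all real and pairwise distinct, with 0 the smallest: there exist real numbers 0 = λ₀ < λ₁ < ⋯ < λ_{N−1} such that a real number λ is an eigenvalue of −Δ^c (i.e., there exists a nonzero f : {1,…,N} → ℝ with Δ^c f = −λ·f) if and only if λ = λ_i for some i ∈ {0,…,N−1}. -/
/-- The generator `Δ^c` of the random walk with conductances `c` on `⟦1, N⟧`: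
`(Δ^c f)(x) = c(x)·(f(x+1) − f(x)) + c(x−1)·(f(x−1) − f(x))`, where the first
term is absent for `x = N` and the second term is absent for `x = 1`. -/
def gen (N : ℕ) (c : ℕ → ℝ) (f : ℕ → ℝ) (x : ℕ) : ℝ :=
  (if x < N then c x * (f (x + 1) - f x) else 0) +
  (if 2 ≤ x then c (x - 1) * (f (x - 1) - f x) else 0)

/-- `lam` is an eigenvalue of `−Δ^c`, i.e. there is a function `f`, nonzero on `⟦1,N⟧`,
with `Δ^c f = −lam·f` on `⟦1,N⟧`. -/
def IsEigenvalue (N : ℕ) (c : ℕ → ℝ) (lam : ℝ) : Prop :=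
  ∃ f : ℕ → ℝ, (∃ x ∈ Finset.Icc 1 N, f x ≠ 0) ∧
    ∀ x ∈ Finset.Icc 1 N, gen N c f x = -lam * f x

theorem gen_sum (M : ℕ) (c f g : ℕ → ℝ) :
    ∑ i ∈ Finset.range (M+1), gen (M+1) c f (i+1) * g (i+1) =
      -∑ i ∈ Finset.range M, c (i+1) * (f (i+2) - f (i+1)) * (g (i+2) - g (i+1)) := by
  simp only [gen, add_mul, Finset.sum_add_distrib]
  rw [Finset.sum_range_succ, Finset.sum_range_succ', ← Finset.sum_neg_distrib]
  simp only [lt_irrefl, if_false, zero_mul, add_zero]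
  rw [if_neg (by norm_num), zero_mul, add_zero, ← Finset.sum_add_distrib]
  refine Finset.sum_congr rfl fun i hi => ?_
  rw [Finset.mem_range] at hi
  rw [if_pos (by omega), if_pos (by omega)]
  simp only [Nat.add_sub_cancel]
  ring

theorem gen_uniq (N : ℕ) (c f : ℕ → ℝ) (hc : ∀ x, 1 ≤ x → x ≤ N - 1 → 0 < c x) (μ : ℝ)
    (h : ∀ x ∈ Finset.Icc 1 N, gen N c f x = μ * f x) (h1 : f 1 = 0) :
    ∀ k, k + 1 ≤ N → f (k+1) = 0 := by
  intro k
  induction k using Nat.strong_induction_on with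
  | _ k ih =>
    intro hk
    rcases k with _ | k
    · exact h1
    have e := h (k+1) (by simp; omega)
    have e0 := ih k (by omega) (by omega)
    have hcp := hc (k+1) (by omega) (by omega)
    unfold gen at e
    rw [if_pos (by omega), e0] at e
    have e2 : (if 2 ≤ k+1 then c (k+1-1) * (f (k+1-1) - 0) else 0) = 0 := by
      split_ifs with h2
      · rcases k with _ | k
        · omega
        · have := ih k (by omega) (by omega)
          simp [this]
      · rfl
    rw [e2] at e
    simp at e
    rcases e with e | e
    · linarith
    · exact e

/-- extension of a vector to a function on the naturals -/
noncomputable def extV (N : ℕ) (v : EuclideanSpace ℝ (Fin N)) (x : ℕ) : ℝ :=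
  if h : x - 1 < N then v ⟨x - 1, h⟩ else 0

theorem extV_succ (N : ℕ) (v : EuclideanSpace ℝ (Fin N)) (i : Fin N) :
    extV N v (i + 1) = v i := by
  simp [extV]

theorem extV_add (N : ℕ) (v w : EuclideanSpace ℝ (Fin N)) (x : ℕ) :
    extV N (v + w) x = extV N v x + extV N w x := by
  unfold extV; split_ifs <;> simp

theorem extV_smul (N : ℕ) (a : ℝ) (w : EuclideanSpace ℝ (Fin N)) (x : ℕ) :
    extV N (a • w) x = a * extV N w x := by
  unfold extV; split_ifs <;> simp

/-- the operator -/
noncomputable def opT (N : ℕ) (c : ℕ → ℝ) :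
    EuclideanSpace ℝ (Fin N) →ₗ[ℝ] EuclideanSpace ℝ (Fin N) where
  toFun v := WithLp.toLp 2 fun i => gen N c (extV N v) (i + 1)
  map_add' v w := by
    ext i
    simp only [gen, extV_add, PiLp.add_apply]
    split_ifs <;> ring
  map_smul' a v := by
    ext i
    simp only [gen, extV_smul, PiLp.smul_apply, smul_eq_mul, RingHom.id_apply]
    split_ifs <;> ring

theorem opT_apply (N : ℕ) (c : ℕ → ℝ) (v : EuclideanSpace ℝ (Fin N)) (i : Fin N) :
    opT N c v i = gen N c (extV N v) (i + 1) := rfl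

theorem opT_inner (M : ℕ) (c : ℕ → ℝ) (v w : EuclideanSpace ℝ (Fin (M+1))) :
    inner ℝ (opT (M+1) c v) w =
      -∑ i ∈ Finset.range M, c (i+1) * (extV (M+1) v (i+2) - extV (M+1) v (i+1))
        * (extV (M+1) w (i+2) - extV (M+1) w (i+1)) := by
  rw [← gen_sum, Finset.sum_range, PiLp.inner_apply]
  refine Finset.sum_congr rfl fun i _ => ?_
  rw [opT_apply, extV_succ]
  simp [mul_comm]

theorem opT_symm (M : ℕ) (c : ℕ → ℝ) : (opT (M+1) c).IsSymmetric := by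
  intro v w
  rw [opT_inner, real_inner_comm, opT_inner]
  congr 1
  exact Finset.sum_congr rfl fun i _ => by ring

theorem gen_congr (N : ℕ) (c f g : ℕ → ℝ) (h : ∀ x ∈ Finset.Icc 1 N, f x = g x) :
    ∀ x ∈ Finset.Icc 1 N, gen N c f x = gen N c g x := by
  intro x hx
  have hx' := Finset.mem_Icc.1 hx
  unfold gen
  congr 1
  · split_ifs with h1
    · rw [h x hx, h (x+1) (by simp; omega)]
    · rfl
  · split_ifs with h1
    · rw [h x hx, h (x-1) (by simp; omega)]
    · rfl

theorem opT_eig_gen (N : ℕ) (c : ℕ → ℝ) (v : EuclideanSpace ℝ (Fin N)) (μ : ℝ)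
    (h : opT N c v = μ • v) :
    ∀ x ∈ Finset.Icc 1 N, gen N c (extV N v) x = μ * extV N v x := by
  intro x hx
  have hx' := Finset.mem_Icc.1 hx
  obtain ⟨k, rfl⟩ : ∃ k, x = k + 1 := ⟨x - 1, by omega⟩
  have := congrArg (fun u : EuclideanSpace ℝ (Fin N) => u ⟨k, by omega⟩) h
  simp only [opT_apply, PiLp.smul_apply, smul_eq_mul] at this
  rw [this, ← extV_succ]

theorem isEig_iff (N : ℕ) (c : ℕ → ℝ) (μ : ℝ) :
    IsEigenvalue N c μ ↔ ∃ v : EuclideanSpace ℝ (Fin N), v ≠ 0 ∧ opT N c v = (-μ) • v := by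
  constructor
  · rintro ⟨f, ⟨x, hx, hfx⟩, hf⟩
    have key : ∀ y ∈ Finset.Icc 1 N,
        extV N (WithLp.toLp 2 fun i => f (i + 1)) y = f y := by
      intro y hy
      have hy' := Finset.mem_Icc.1 hy
      unfold extV
      rw [dif_pos (by omega)]
      simp only
      congr 1
      omega
    refine ⟨WithLp.toLp 2 fun i => f (i + 1), ?_, ?_⟩
    · intro h0
      apply hfx
      rw [← key x hx, h0]
      simp [extV]
    · ext i
      have hi : (i:ℕ) + 1 ∈ Finset.Icc 1 N := by simp
      rw [opT_apply, gen_congr N c _ f key _ hi, hf _ hi]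
      simp
  · rintro ⟨v, hv, h⟩
    refine ⟨extV N v, ?_, opT_eig_gen N c v _ h⟩
    by_contra! hne
    apply hv
    ext i
    rw [← extV_succ]
    exact hne _ (by simp)

/-- The operator `−Δ^c` admits `N` distinct real eigenvalues
`0 = λ₀ < λ₁ < ⋯ < λ_{N−1}`, and these are all its eigenvalues. -/
theorem eigenvalues_distinct (N : ℕ) (hN : 2 ≤ N) (c : ℕ → ℝ)
    (hc : ∀ x, 1 ≤ x → x ≤ N - 1 → 0 < c x) :
    ∃ lam : ℕ → ℝ, lam 0 = 0 ∧ (∀ i j, i < j → j < N → lam i < lam j) ∧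
      ∀ μ : ℝ, IsEigenvalue N c μ ↔ ∃ i < N, μ = lam i := by
  obtain ⟨M, rfl⟩ : ∃ M, N = M + 1 := ⟨N - 1, by omega⟩
  have hT := opT_symm M c
  have hn : Module.finrank ℝ (EuclideanSpace ℝ (Fin (M+1))) = M+1 := by simp
  have hanti := hT.eigenvalues_antitone hn
  have hb := hT.apply_eigenvectorBasis hn
  set e := hT.eigenvalues hn with he
  set b := hT.eigenvectorBasis hn with hbdef
  have hinj : Function.Injective e := by
    intro i j hij
    by_contra hne
    have hi := hb i
    have hj := hb j
    simp only [RCLike.ofReal_real_eq_id, id] at hi hj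
    rw [← hij] at hj
    set p := extV (M+1) (b j) 1
    set q := extV (M+1) (b i) 1
    have hw : opT (M+1) c (p • b i + (-q) • b j) = e i • (p • b i + (-q) • b j) := by
      rw [map_add, map_smul, map_smul, hi, hj, smul_add, smul_comm, smul_comm (-q)]
    have hz : ∀ u : EuclideanSpace ℝ (Fin (M+1)), opT (M+1) c u = e i • u →
        extV (M+1) u 1 = 0 → u = 0 := by
      intro u hu hu1
      ext k
      rw [← extV_succ]
      exact gen_uniq (M+1) c _ hc _ (opT_eig_gen _ _ _ _ hu) hu1 k (by omega)
    have h0 := hz _ hw (by rw [extV_add, extV_smul, extV_smul]; ring)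
    have hp : p = 0 := by
      have := congrArg (fun u => inner ℝ (b i) u) h0
      simpa [inner_add_right, inner_smul_right, b.inner_eq_ite, hne] using this
    exact b.orthonormal.ne_zero j (hz _ hj hp)
  have hstrict : StrictAnti e := hanti.strictAnti_of_injective hinj
  have hiff : ∀ μ : ℝ, IsEigenvalue (M+1) c μ ↔ ∃ i, μ = - e i := by
    intro μ
    rw [isEig_iff]
    constructor
    · rintro ⟨v, hv, h⟩
      by_contra! hne
      apply hv
      apply b.repr.injective
      ext i
      rw [b.repr_apply_apply, b.repr_apply_apply]
      have h1 := hT (b i) v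
      have hi := hb i
      simp only [RCLike.ofReal_real_eq_id, id] at hi
      rw [h, hi, inner_smul_left, inner_smul_right] at h1
      simp only [conj_trivial] at h1
      have : (e i + μ) * inner ℝ (b i) v = 0 := by linarith
      rcases mul_eq_zero.1 this with h2 | h2
      · exact absurd (by linarith) (hne i)
      · simpa using h2
    · rintro ⟨i, rfl⟩
      exact ⟨b i, b.orthonormal.ne_zero i, by simpa using hb i⟩
  have hnp : ∀ i, e i ≤ 0 := by
    intro i
    have hi := hb i
    simp only [RCLike.ofReal_real_eq_id, id] at hi
    have h1 := opT_inner M c (b i) (b i)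
    rw [hi, inner_smul_left, b.inner_eq_ite] at h1
    simp only [conj_trivial, if_true, mul_one] at h1
    rw [h1, neg_nonpos]
    refine Finset.sum_nonneg fun k hk => ?_
    rw [Finset.mem_range] at hk
    rw [mul_assoc]
    exact mul_nonneg (hc _ (by omega) (by omega)).le (mul_self_nonneg _)
  have h0 : IsEigenvalue (M+1) c 0 := by
    refine ⟨fun _ => 1, ⟨1, by simp, by simp⟩, fun x _ => by simp [gen]⟩
  obtain ⟨i0, hi0⟩ := (hiff 0).1 h0
  have he0 : e 0 = 0 := le_antisymm (hnp 0) (by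
    have := hanti (Fin.zero_le i0)
    linarith)
  refine ⟨fun n => if h : n < M+1 then - e ⟨n, h⟩ else 0, ?_, ?_, ?_⟩
  · simpa using he0
  · intro i j hij hj
    simp only
    rw [dif_pos (by omega), dif_pos hj, neg_lt_neg_iff]
    exact hstrict (by simpa using hij)
  · intro μ
    rw [hiff]
    constructor
    · rintro ⟨i, rfl⟩
      exact ⟨i, i.2, by simp only; rw [dif_pos i.2]⟩
    · rintro ⟨i, hi, rfl⟩
      exact ⟨⟨i, hi⟩, by simp [hi]⟩
end

section
/- Let N ≥ 2 and let c : {1,…,N−1} → ℝ satisfy c(x) > 0 for all x. Let λ₁ be the smallest strictly positive eigenvalue of −Δ^c, and let g : {1,…,N} → ℝ be any nonzero function with Δ^c g = −λ₁·g. Then g is strictly monotone: either g(x) > g(x+1) for all 1 ≤ x ≤ N−1, or g(x) < g(x+1) for all 1 ≤ x ≤ N−1. -/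
/-- Shooting solution: partial sums. -/
noncomputable def SS (c : ℕ → ℝ) (t : ℝ) : ℕ → ℝ
  | 0 => 0
  | 1 => 1
  | (n + 2) => SS c t (n + 1) + (SS c t (n + 1) - SS c t n) - t * SS c t (n + 1) / c (n + 1)

lemma SS_rec (c : ℕ → ℝ) (t : ℝ) (n : ℕ) : SS c t (n + 2) =
    SS c t (n + 1) + (SS c t (n + 1) - SS c t n) - t * SS c t (n + 1) / c (n + 1) := by
  rw [SS]

lemma SS_cont (c : ℕ → ℝ) (n : ℕ) :
    Continuous (fun t => SS c t n) ∧ Continuous (fun t => SS c t (n + 1)) := by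
  induction n with
  | zero => simp only [SS]; exact ⟨continuous_const, continuous_const⟩
  | succ n ih =>
    refine ⟨ih.2, ?_⟩
    simp only [SS_rec]
    have h1 := ih.1
    have h2 := ih.2
    simp only [div_eq_mul_inv]
    fun_prop

lemma SS_zero (c : ℕ → ℝ) (n : ℕ) :
    SS c 0 n = n ∧ SS c 0 (n + 1) = n + 1 := by
  induction n with
  | zero => simp [SS]
  | succ n ih =>
    refine ⟨by push_cast; exact ih.2, ?_⟩
    rw [SS_rec, ih.1, ih.2]; push_cast; ring

lemma SS_exists_zero (c : ℕ → ℝ) (n : ℕ) (t : ℝ) (ht : 0 < t) (h : SS c t (n + 1) ≤ 0) :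
    ∃ s, 0 < s ∧ s ≤ t ∧ SS c s (n + 1) = 0 := by
  have h0 := (SS_zero c n).2
  have hn : (0 : ℝ) < n + 1 := by positivity
  obtain ⟨s, hs, hs0⟩ := intermediate_value_Icc' ht.le ((SS_cont c n).2.continuousOn)
    (show (0 : ℝ) ∈ Set.Icc _ _ from ⟨h, by rw [h0]; exact hn.le⟩)
  simp only at hs0
  refine ⟨s, lt_of_le_of_ne hs.1 ?_, hs.2, hs0⟩
  rintro rfl
  linarith

lemma SS_step (c : ℕ → ℝ) (n : ℕ) : ∀ t : ℝ, 0 < t → SS c t (n + 1) ≤ 0 →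
    ∃ s, 0 < s ∧ s < t ∧ SS c s (n + 2) = 0 := by
  induction n with
  | zero => intro t _ h; simp only [SS] at h; norm_num at h
  | succ n ih =>
    intro t ht h
    obtain ⟨s, hs, hst, hs0⟩ := SS_exists_zero c (n + 1) t ht h
    have hcl : IsClosed {u : ℝ | SS c u (n + 1 + 1) = 0} :=
      isClosed_eq (SS_cont c (n + 1)).2 continuous_const
    have hK : IsCompact (Set.Icc 0 t ∩ {u : ℝ | SS c u (n + 1 + 1) = 0}) :=
      isCompact_Icc.inter_right hcl
    obtain ⟨u, ⟨⟨hu, hu0⟩, humin⟩⟩ := hK.exists_isLeast ⟨s, ⟨hs.le, hst⟩, hs0⟩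
    have hu0' : SS c u (n + 1 + 1) = 0 := hu0
    have hupos : 0 < u := by
      refine lt_of_le_of_ne hu.1 ?_
      rintro rfl
      have := (SS_zero c (n + 1)).2
      have hn : (0 : ℝ) ≤ ((n + 1 : ℕ) : ℝ) := by positivity
      linarith
    have hprev : 0 < SS c u (n + 1) := by
      by_contra hcon
      obtain ⟨v, hv, hvu, hv0⟩ := ih u hupos (not_lt.mp hcon)
      have := humin ⟨⟨hv.le, hvu.le.trans hu.2⟩, hv0⟩
      linarith
    have hneg : SS c u (n + 1 + 2) < 0 := by
      rw [SS_rec, hu0']; simp; exact hprev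
    obtain ⟨v, hv, hvu, hv0⟩ := SS_exists_zero c (n + 2) u hupos hneg.le
    refine ⟨v, hv, lt_of_lt_of_le (lt_of_le_of_ne hvu ?_) hu.2, hv0⟩
    rintro rfl
    exact absurd hv0 hneg.ne

lemma SS_iter (c : ℕ → ℝ) (n k : ℕ) (t : ℝ) (ht : 0 < t) (h : SS c t (n + 1) ≤ 0) :
    ∃ s, 0 < s ∧ s < t ∧ SS c s (n + 2 + k) = 0 := by
  induction k with
  | zero => exact SS_step c n t ht h
  | succ k ih =>
    obtain ⟨s, hs, hst, hs0⟩ := ih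
    obtain ⟨v, hv, hvs, hv0⟩ := SS_step c (n + 1 + k) s hs
      (by rw [show n + 1 + k + 1 = n + 2 + k by omega]; exact hs0.le)
    exact ⟨v, hv, hvs.trans hst, by rw [show n + 2 + (k + 1) = n + 1 + k + 2 by omega]; exact hv0⟩

lemma SS_flux (c : ℕ → ℝ) (t : ℝ) (n : ℕ) (h : 0 < c (n + 1)) :
    c (n + 1) * ((SS c t (n + 2) - SS c t (n + 1)) - (SS c t (n + 1) - SS c t n))
      = -t * SS c t (n + 1) := by
  rw [SS_rec]; field_simp; ring

lemma SS_eig (N : ℕ) (hN : 2 ≤ N) (c : ℕ → ℝ) (hc : ∀ x, 1 ≤ x → x ≤ N - 1 → 0 < c x)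
    (t : ℝ) (h : SS c t N = 0) : IsEigenvalue N c t := by
  refine ⟨fun x => SS c t x - SS c t (x - 1), ⟨1, by simp; omega, by simp [SS]⟩, ?_⟩
  intro x hx
  rw [Finset.mem_Icc] at hx
  obtain ⟨n, rfl⟩ : ∃ n, x = n + 1 := ⟨x - 1, by omega⟩
  have e1 : (if n + 1 < N then c (n + 1) * ((SS c t (n + 1 + 1) - SS c t (n + 1 + 1 - 1))
      - (SS c t (n + 1) - SS c t (n + 1 - 1))) else 0) = -t * SS c t (n + 1) := by
    split_ifs with h1
    · exact SS_flux c t n (hc _ (by omega) (by omega))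
    · have : n + 1 = N := by omega
      rw [this, h]; simp
  have e2 : (if 2 ≤ n + 1 then c (n + 1 - 1) * ((SS c t (n + 1 - 1) - SS c t (n + 1 - 1 - 1))
      - (SS c t (n + 1) - SS c t (n + 1 - 1))) else 0) = t * SS c t n := by
    split_ifs with h1
    · obtain ⟨m, rfl⟩ : ∃ m, n = m + 1 := ⟨n - 1, by omega⟩
      have := SS_flux c t m (hc _ (by omega) (by omega))
      simp only [Nat.add_sub_cancel]
      linarith
    · have : n = 0 := by omega
      subst this; simp [SS]
  unfold gen
  simp only
  rw [e1, e2]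
  simp only [Nat.add_sub_cancel]
  ring

lemma SS_g (N : ℕ) (c : ℕ → ℝ) (hc : ∀ x, 1 ≤ x → x ≤ N - 1 → 0 < c x)
    (t : ℝ) (g : ℕ → ℝ) (hg : ∀ x ∈ Finset.Icc 1 N, gen N c g x = -t * g x) (n : ℕ)
    (hn : n + 1 < N) :
    g (n + 1) = g 1 * (SS c t (n + 1) - SS c t n) ∧
    c (n + 1) * (g (n + 2) - g (n + 1)) = -t * (g 1 * SS c t (n + 1)) := by
  induction n with
  | zero =>
    have := hg 1 (by simp; omega)
    simp only [gen] at this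
    rw [if_pos (by omega), if_neg (by omega)] at this
    simp [SS] at this ⊢
    linarith
  | succ n ih =>
    obtain ⟨h1, h2⟩ := ih (by omega)
    have hcp := hc (n + 1) (by omega) (by omega)
    have h3 : g (n + 2) = g 1 * (SS c t (n + 2) - SS c t (n + 1)) := by
      have hf := SS_flux c t n hcp
      apply mul_left_cancel₀ hcp.ne'
      linear_combination h2 + c (n + 1) * h1 - g 1 * hf
    refine ⟨h3, ?_⟩
    have := hg (n + 2) (by simp; omega)
    simp only [gen] at this
    rw [if_pos (by omega), if_pos (by omega)] at this
    simp only [show n + 2 - 1 = n + 1 by omega] at this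
    show c (n + 2) * (g (n + 2 + 1) - g (n + 2)) = -t * (g 1 * SS c t (n + 2))
    linear_combination this + h2 - t * h3

/-- Any eigenfunction corresponding to the smallest strictly positive eigenvalue `λ₁`
of `−Δ^c` is strictly monotone on `⟦1, N⟧`. -/
theorem principal_eigenfunction_strictMono (N : ℕ) (hN : 2 ≤ N) (c : ℕ → ℝ)
    (hc : ∀ x, 1 ≤ x → x ≤ N - 1 → 0 < c x)
    (lam₁ : ℝ) (hpos : 0 < lam₁) (heig : IsEigenvalue N c lam₁)
    (hmin : ∀ μ : ℝ, 0 < μ → IsEigenvalue N c μ → lam₁ ≤ μ)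
    (g : ℕ → ℝ) (hg0 : ∃ x ∈ Finset.Icc 1 N, g x ≠ 0)
    (hg : ∀ x ∈ Finset.Icc 1 N, gen N c g x = -lam₁ * g x) :
    (∀ x, 1 ≤ x → x ≤ N - 1 → g (x + 1) < g x) ∨
    (∀ x, 1 ≤ x → x ≤ N - 1 → g x < g (x + 1)) := by
  have hS : ∀ n, n + 1 < N → 0 < SS c lam₁ (n + 1) := by
    intro n hn
    by_contra hcon
    obtain ⟨s, hs, hst, hs0⟩ := SS_iter c n (N - (n + 2)) lam₁ hpos (not_lt.mp hcon)
    rw [show n + 2 + (N - (n + 2)) = N by omega] at hs0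
    have := hmin s hs (SS_eig N hN c hc s hs0)
    linarith
  have hG := SS_g N c hc lam₁ g hg
  have hg1 : g 1 ≠ 0 := by
    intro h0
    obtain ⟨x, hx, hx0⟩ := hg0
    rw [Finset.mem_Icc] at hx
    apply hx0
    rcases Nat.lt_or_ge x N with h | h
    · obtain ⟨n, rfl⟩ : ∃ n, x = n + 1 := ⟨x - 1, by omega⟩
      rw [(hG n h).1, h0, zero_mul]
    · obtain ⟨n, rfl⟩ : ∃ n, x = n + 2 := ⟨x - 2, by omega⟩
      obtain ⟨h1, h2⟩ := hG n (by omega)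
      have hcp := hc (n + 1) (by omega) (by omega)
      rw [h0] at h1 h2
      simp only [zero_mul, mul_zero] at h1 h2
      rcases mul_eq_zero.mp h2 with h3 | h3 <;> linarith
  have key : ∀ x, 1 ≤ x → x ≤ N - 1 → 0 < c x ∧
      ∃ p, 0 < p ∧ c x * (g (x + 1) - g x) = - (g 1 * p) := by
    intro x h1 h2
    obtain ⟨n, rfl⟩ : ∃ n, x = n + 1 := ⟨x - 1, by omega⟩
    refine ⟨hc _ h1 h2, lam₁ * SS c lam₁ (n + 1), mul_pos hpos (hS n (by omega)), ?_⟩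
    rw [(hG n (by omega)).2]; ring
  rcases lt_or_gt_of_ne hg1 with h | h
  · right
    intro x h1 h2
    obtain ⟨hcp, p, hp, e⟩ := key x h1 h2
    have := mul_neg_of_neg_of_pos h hp
    have h3 : 0 < c x * (g (x + 1) - g x) := by linarith
    linarith [(mul_pos_iff_of_pos_left hcp).mp h3]
  · left
    intro x h1 h2
    obtain ⟨hcp, p, hp, e⟩ := key x h1 h2
    have := mul_pos h hp
    have h3 : 0 < c x * (g x - g (x + 1)) := by linarith
    linarith [(mul_pos_iff_of_pos_left hcp).mp h3]
end

section
/- Let N ≥ 2 and let c : {1,…,N−1} → ℝ satisfy c(x) > 0 for all x, and write the eigenvalues of −Δ^c as 0 = λ₀ < λ₁ < ⋯ < λ_{N−1}. For every j with 2 ≤ j ≤ N−1, any nonzero function g_j : {1,…,N} → ℝ with Δ^c g_j = −λ_j·g_j is j-monotone: the number of intervals ⟦b,c⟧ with 2 ≤ b ≤ c ≤ N−1 at which g_j admits a local extremum is exactly j−1. -/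
/-- `f` admits a local maximum at `⟦b, c⟧`. -/
def AdmitsLocalMax (N : ℕ) (f : ℕ → ℝ) (b c : ℕ) : Prop :=
  2 ≤ b ∧ b ≤ c ∧ c ≤ N - 1 ∧ (∀ x ∈ Finset.Icc b c, f x = f b) ∧
    f (b - 1) < f b ∧ f (c + 1) < f c

/-- `f` admits a local minimum at `⟦b, c⟧`. -/
def AdmitsLocalMin (N : ℕ) (f : ℕ → ℝ) (b c : ℕ) : Prop :=
  2 ≤ b ∧ b ≤ c ∧ c ≤ N - 1 ∧ (∀ x ∈ Finset.Icc b c, f x = f b) ∧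
    f b < f (b - 1) ∧ f c < f (c + 1)

/-- `f` admits a local extremum at `⟦b, c⟧`. -/
def AdmitsLocalExtremum (N : ℕ) (f : ℕ → ℝ) (b c : ℕ) : Prop :=
  AdmitsLocalMax N f b c ∨ AdmitsLocalMin N f b c

/-- canonical flux -/
noncomputable def pp (c : ℕ → ℝ) (l : ℝ) : ℕ → ℝ
  | 0 => 0
  | 1 => 1
  | (x + 2) => (2 - l / c (x + 1)) * pp c l (x + 1) - pp c l x

lemma pp_ss (c : ℕ → ℝ) (l : ℝ) (x : ℕ) :
    pp c l (x + 2) = (2 - l / c (x + 1)) * pp c l (x + 1) - pp c l x := by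
  rw [pp]

def Node (c : ℕ → ℝ) (l : ℝ) (y : ℕ) : Prop := pp c l y ≠ 0 ∧ pp c l y * pp c l (y + 1) ≤ 0

open Classical in
noncomputable def cnt (c : ℕ → ℝ) (l : ℝ) (x : ℕ) : ℕ := ((Finset.range x).filter (Node c l)).card

lemma cnt_succ_node {c : ℕ → ℝ} {l : ℝ} {x : ℕ} (h : Node c l x) :
    cnt c l (x + 1) = cnt c l x + 1 := by
  unfold cnt
  rw [Finset.range_add_one, Finset.filter_insert, if_pos h, Finset.card_insert_of_notMem (by simp)]

lemma cnt_succ_not {c : ℕ → ℝ} {l : ℝ} {x : ℕ} (h : ¬ Node c l x) :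
    cnt c l (x + 1) = cnt c l x := by
  unfold cnt
  rw [Finset.range_add_one, Finset.filter_insert, if_neg h]

lemma not_node_zero (c : ℕ → ℝ) (l : ℝ) : ¬ Node c l 0 := by
  simp [Node, pp]

lemma cnt_one (c : ℕ → ℝ) (l : ℝ) : cnt c l 1 = 0 := by
  have := cnt_succ_not (not_node_zero c l)
  simpa [cnt] using this

lemma cnt_le (c : ℕ → ℝ) (l : ℝ) (x : ℕ) : cnt c l (x + 1) ≤ x := by
  induction x with
  | zero => simp [cnt_one]
  | succ n ih =>
    by_cases h : Node c l (n + 1)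
    · rw [cnt_succ_node h]; omega
    · rw [cnt_succ_not h]; omega

/-- signed pair -/
noncomputable def aa (c : ℕ → ℝ) (l : ℝ) (x : ℕ) : ℝ := (-1) ^ cnt c l x * pp c l x
noncomputable def bb (c : ℕ → ℝ) (l : ℝ) (x : ℕ) : ℝ := (-1) ^ cnt c l x * pp c l (x + 1)

lemma aa_mul_bb (c : ℕ → ℝ) (l : ℝ) (x : ℕ) : aa c l x * bb c l x = pp c l x * pp c l (x + 1) := by
  unfold aa bb
  have : ((-1 : ℝ) ^ cnt c l x) * ((-1 : ℝ) ^ cnt c l x) = 1 := by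
    rw [← mul_pow]; simp
  linear_combination (pp c l x * pp c l (x + 1)) * this

lemma aa_eq_zero (c : ℕ → ℝ) (l : ℝ) (x : ℕ) : aa c l x = 0 ↔ pp c l x = 0 := by
  simp [aa]

lemma node_iff {c : ℕ → ℝ} {l : ℝ} {x : ℕ}
    (h : 0 < aa c l x ∨ (aa c l x = 0 ∧ 0 < bb c l x)) : Node c l x ↔ bb c l x ≤ 0 := by
  unfold Node
  rw [← aa_mul_bb, ne_eq, ← aa_eq_zero]
  rcases h with h | ⟨h, h'⟩
  · constructor
    · rintro ⟨_, h2⟩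
      by_contra! h3
      nlinarith [mul_pos h h3]
    · intro h2
      exact ⟨h.ne', by nlinarith⟩
  · simp [h, h']

lemma step_node {c : ℕ → ℝ} {l : ℝ} {x : ℕ} (h : Node c l x) :
    aa c l (x + 1) = - bb c l x ∧
    bb c l (x + 1) = aa c l x - (2 - l / c (x + 1)) * bb c l x := by
  unfold aa bb
  rw [cnt_succ_node h, pp_ss, pow_succ]
  constructor <;> ring

lemma step_not {c : ℕ → ℝ} {l : ℝ} {x : ℕ} (h : ¬ Node c l x) :
    aa c l (x + 1) = bb c l x ∧
    bb c l (x + 1) = (2 - l / c (x + 1)) * bb c l x - aa c l x := by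
  unfold aa bb
  rw [cnt_succ_not h, pp_ss]
  constructor <;> ring

lemma half (c : ℕ → ℝ) (l : ℝ) (x : ℕ) :
    0 < aa c l x ∨ (aa c l x = 0 ∧ 0 < bb c l x) := by
  induction x with
  | zero => right; simp [aa, bb, pp, cnt]
  | succ n ih =>
    have hn := node_iff ih
    by_cases h : Node c l n
    · obtain ⟨h1, h2⟩ := step_node h
      have h3 := hn.1 h
      rcases h3.lt_or_eq with h4 | h4
      · left; linarith
      · right
        rw [h1, h2, h4]
        rcases ih with h5 | h5
        · simpa using h5
        · linarith [h5.2]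
    · obtain ⟨h1, h2⟩ := step_not h
      left
      rw [h1]
      by_contra! h3
      exact h (hn.2 h3)

lemma half_nonneg (c : ℕ → ℝ) (l : ℝ) (x : ℕ) : 0 ≤ aa c l x := by
  rcases half c l x with h | h
  · exact h.le
  · exact h.1.ge

lemma pp_no_consec (c : ℕ → ℝ) (l : ℝ) (x : ℕ) (h : pp c l x = 0) : pp c l (x + 1) ≠ 0 := by
  intro h'
  have := half c l x
  simp [aa, bb, h, h'] at this

lemma sturm {c : ℕ → ℝ} {l m : ℝ} (hlm : l < m) (x : ℕ) (hc : ∀ y, 1 ≤ y → y ≤ x + 1 → 0 < c y) :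
    cnt c l (x + 1) < cnt c m (x + 1) ∨ (cnt c l (x + 1) = cnt c m (x + 1) ∧
      aa c l (x + 1) * bb c m (x + 1) - bb c l (x + 1) * aa c m (x + 1) < 0) := by
  induction x with
  | zero =>
    right
    have h1 := hc 1 le_rfl (by simp)
    have : l / c 1 < m / c 1 := by gcongr
    simp [cnt_one, aa, bb, pp, this]
  | succ n ih =>
    have ih := ih (fun y h1 h2 => hc y h1 (by omega))
    have hcn := hc (n + 2) (by omega) (by omega)
    have hd : 0 < m / c (n + 2) - l / c (n + 2) := by
      have : l / c (n + 2) < m / c (n + 2) := by gcongr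
      linarith
    have hl := half c l (n + 1)
    have hm := half c m (n + 1)
    have hl0 := half_nonneg c l (n + 1)
    have hm0 := half_nonneg c m (n + 1)
    have nl := node_iff hl
    have nm := node_iff hm
    by_cases hL : Node c l (n + 1) <;> by_cases hM : Node c m (n + 1)
    · have bl := nl.1 hL
      have bm := nm.1 hM
      rw [cnt_succ_node hL, cnt_succ_node hM]
      obtain ⟨e1, e2⟩ := step_node hL
      obtain ⟨e3, e4⟩ := step_node hM
      rcases ih with ih | ⟨ih1, ih2⟩
      · left; omega
      · right
        refine ⟨by omega, ?_⟩
        rw [e1, e2, e3, e4]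
        nlinarith [mul_nonneg hd.le (mul_nonneg_of_nonpos_of_nonpos bl bm)]
    · have bl := nl.1 hL
      have bm : 0 < bb c m (n + 1) := by
        by_contra! h; exact hM (nm.2 h)
      have al : 0 < aa c l (n + 1) := by
        rcases hl with h | h
        · exact h
        · linarith [h.2]
      rw [cnt_succ_node hL, cnt_succ_not hM]
      obtain ⟨e1, e2⟩ := step_node hL
      obtain ⟨e3, e4⟩ := step_not hM
      rcases ih with ih | ⟨ih1, ih2⟩
      · rcases Nat.lt_or_ge (cnt c l (n + 1) + 1) (cnt c m (n + 1)) with h | h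
        · left; exact h
        · right
          refine ⟨by omega, ?_⟩
          rw [e1, e2, e3, e4]
          nlinarith [mul_nonneg hd.le (mul_nonneg (neg_nonneg.2 bl) bm.le), mul_pos al bm,
            mul_nonneg (neg_nonneg.2 bl) hm0]
      · exfalso
        nlinarith [mul_pos al bm, mul_nonneg (neg_nonneg.2 bl) hm0]
    · left
      rw [cnt_succ_not hL, cnt_succ_node hM]
      omega
    · have bl : 0 < bb c l (n + 1) := by
        by_contra! h; exact hL (nl.2 h)
      have bm : 0 < bb c m (n + 1) := by
        by_contra! h; exact hM (nm.2 h)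
      rw [cnt_succ_not hL, cnt_succ_not hM]
      obtain ⟨e1, e2⟩ := step_not hL
      obtain ⟨e3, e4⟩ := step_not hM
      rcases ih with ih | ⟨ih1, ih2⟩
      · left; omega
      · right
        refine ⟨by omega, ?_⟩
        rw [e1, e2, e3, e4]
        nlinarith [mul_nonneg hd.le (mul_nonneg bl.le bm.le)]

lemma sturm_strict {c : ℕ → ℝ} {l m : ℝ} (hlm : l < m) (N : ℕ) (hN : 2 ≤ N)
    (hc : ∀ y, 1 ≤ y → y ≤ N - 1 → 0 < c y) (hl : pp c l N = 0) (hm : pp c m N = 0) :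
    cnt c l (N - 1) < cnt c m (N - 1) := by
  obtain ⟨n, rfl⟩ : ∃ n, N = n + 2 := ⟨N - 2, by omega⟩
  rcases sturm hlm n hc with h | ⟨_, h⟩
  · exact h
  · simp [bb, hl, hm] at h

lemma flux (N : ℕ) (hN : 2 ≤ N) (c : ℕ → ℝ) (hc : ∀ x, 1 ≤ x → x ≤ N - 1 → 0 < c x)
    (l : ℝ) (hl : l ≠ 0) (f : ℕ → ℝ) (hf0 : ∃ x ∈ Finset.Icc 1 N, f x ≠ 0)
    (hf : ∀ x ∈ Finset.Icc 1 N, gen N c f x = -l * f x) :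
    ∃ k : ℝ, k ≠ 0 ∧ (∀ x, 1 ≤ x → x ≤ N - 1 → c x * (f (x + 1) - f x) = k * pp c l x) ∧
      pp c l N = 0 := by
  set u : ℕ → ℝ := fun x => if 1 ≤ x ∧ x < N then c x * (f (x + 1) - f x) else 0 with hu
  have hu0 : u 0 = 0 := by simp [hu]
  have huN : u N = 0 := by simp [hu]
  have hux : ∀ x, 1 ≤ x → x < N → u x = c x * (f (x + 1) - f x) := by
    intro x h1 h2
    simp only [hu]; rw [if_pos ⟨h1, h2⟩]
  have hrec : ∀ x, x + 1 ≤ N → u (x + 1) - u x = -l * f (x + 1) := by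
    intro x hx
    rw [← hf (x + 1) (by simp; omega)]
    unfold gen
    rcases Nat.eq_zero_or_pos x with h0 | h0
    · subst h0
      rw [hu0, hux 1 le_rfl (by omega), if_pos (by omega), if_neg (by omega)]; ring_nf
    · rw [hux x h0 (by omega), if_pos (show 2 ≤ x + 1 by omega)]
      rcases Nat.lt_or_ge (x + 1) N with h | h
      · rw [hux (x + 1) (by omega) h, if_pos h]
        simp only [Nat.add_sub_cancel]; ring
      · have : x + 1 = N := by omega
        rw [this, huN, if_neg (by omega), ← this]
        simp only [Nat.add_sub_cancel]; ring
  have key : ∀ x, (x ≤ N → u x = u 1 * pp c l x) ∧ (x + 1 ≤ N → u (x + 1) = u 1 * pp c l (x + 1)) := by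
    intro x
    induction x with
    | zero => simp [hu0, pp]
    | succ n ih =>
      refine ⟨ih.2, fun h => ?_⟩
      have i1 := ih.1 (by omega)
      have i2 := ih.2 (by omega)
      have r1 := hrec n (by omega)
      have r2 := hrec (n + 1) h
      have e := hux (n + 1) (by omega) (by omega)
      have hcn := hc (n + 1) (by omega) (by omega)
      have e' : f (n + 1 + 1) - f (n + 1) = u (n + 1) / c (n + 1) := by
        rw [e]; field_simp
      rw [show n + 1 + 1 = n + 2 from rfl, pp_ss]
      have : u (n + 2) = (2 - l / c (n + 1)) * u (n + 1) - u n := by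
        have e3 : u (n + 1 + 1) - u (n + 1) - (u (n + 1) - u n) = -l * (u (n + 1) / c (n + 1)) := by
          rw [← e', r1, r2]; ring
        rw [show n + 1 + 1 = n + 2 from rfl] at e3
        linear_combination e3
      rw [this, i1, i2]; ring
  have hk : u 1 ≠ 0 := by
    intro h
    obtain ⟨x, hx, hfx⟩ := hf0
    simp only [Finset.mem_Icc] at hx
    have r := hrec (x - 1) (by omega)
    rw [(key (x - 1)).1 (by omega), (key (x - 1)).2 (by omega), h, show x - 1 + 1 = x by omega] at r
    have : l * f x = 0 := by linarith
    rcases mul_eq_zero.1 this with h | h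
    · exact hl h
    · exact hfx h
  refine ⟨u 1, hk, fun x h1 h2 => ?_, ?_⟩
  · rw [← hux x h1 (by omega), (key x).1 (by omega)]
  · have := (key N).1 le_rfl
    rw [huN] at this
    exact (mul_eq_zero.1 this.symm).resolve_left hk

lemma ext_iff (N : ℕ) (f : ℕ → ℝ) (b c : ℕ) : AdmitsLocalExtremum N f b c ↔
    2 ≤ b ∧ b ≤ c ∧ c ≤ N - 1 ∧ (∀ x ∈ Finset.Icc b c, f x = f b) ∧
    (f b - f (b - 1)) * (f (c + 1) - f c) < 0 := by
  unfold AdmitsLocalExtremum AdmitsLocalMax AdmitsLocalMin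
  rw [mul_neg_iff]
  simp only [sub_pos, sub_neg]
  tauto

open Classical in
lemma count_ext (N : ℕ) (hN : 2 ≤ N) (c : ℕ → ℝ) (hc : ∀ x, 1 ≤ x → x ≤ N - 1 → 0 < c x)
    (l k : ℝ) (hk : k ≠ 0) (f : ℕ → ℝ)
    (hf : ∀ x, 1 ≤ x → x ≤ N - 1 → c x * (f (x + 1) - f x) = k * pp c l x)
    (hp : pp c l N = 0) :
    {p : ℕ × ℕ | AdmitsLocalExtremum N f p.1 p.2}.ncard = cnt c l (N - 1) := by
  have hd : ∀ x, 1 ≤ x → x ≤ N - 1 → f (x + 1) - f x = k / c x * pp c l x := by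
    intro x h1 h2
    have := hc x h1 h2
    have e := hf x h1 h2
    field_simp
    linarith
  have hdz : ∀ x, 1 ≤ x → x ≤ N - 1 → (f (x + 1) = f x ↔ pp c l x = 0) := by
    intro x h1 h2
    have := hc x h1 h2
    rw [← sub_eq_zero, hd x h1 h2]
    simp [hk, this.ne']
  have hdd : ∀ x y, 1 ≤ x → x ≤ N - 1 → 1 ≤ y → y ≤ N - 1 →
      ((f (x + 1) - f x) * (f (y + 1) - f y) < 0 ↔ pp c l x * pp c l y < 0) := by
    intro x y h1 h2 h3 h4
    have p1 := hc x h1 h2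
    have p2 := hc y h3 h4
    rw [hd x h1 h2, hd y h3 h4]
    have : 0 < k / c x * (k / c y) := by
      rw [div_mul_div_comm]
      exact div_pos (mul_self_pos.2 hk) (mul_pos p1 p2)
    rw [show k / c x * pp c l x * (k / c y * pp c l y)
      = (k / c x * (k / c y)) * (pp c l x * pp c l y) by ring]
    constructor
    · intro h; by_contra! h'; nlinarith [mul_nonneg this.le h']
    · intro h; exact mul_neg_of_pos_of_neg this h
  let F : ℕ → ℕ × ℕ := fun y => (y + 1, if pp c l (y + 1) = 0 then y + 2 else y + 1)
  have hF : Function.Injective F := by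
    intro a b h
    have := congrArg Prod.fst h
    simpa [F] using this
  have hset : {p : ℕ × ℕ | AdmitsLocalExtremum N f p.1 p.2}
      = (((Finset.range (N - 1)).filter (Node c l)).image F : Finset (ℕ × ℕ)) := by
    ext ⟨b, e⟩
    simp only [Set.mem_setOf_eq, Finset.coe_image, Set.mem_image, Finset.coe_filter,
      Finset.mem_range, ext_iff]
    constructor
    · rintro ⟨h1, h2, h3, h4, h5⟩
      obtain ⟨y, rfl⟩ : ∃ y, b = y + 1 := ⟨b - 1, by omega⟩
      rw [show y + 1 - 1 = y by omega, hdd y e (by omega) (by omega) (by omega) h3] at h5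
      have hy0 : pp c l y ≠ 0 := by rintro h; simp [h] at h5
      have hz : ∀ x, y + 1 ≤ x → x + 1 ≤ e → pp c l x = 0 := by
        intro x hx1 hx2
        rw [← hdz x (by omega) (by omega), h4 (x + 1) (by simp; omega), h4 x (by simp; omega)]
      have he : e ≤ y + 2 := by
        by_contra! h
        exact pp_no_consec c l _ (hz (y + 1) le_rfl (by omega)) (hz (y + 2) (by omega) (by omega))
      refine ⟨y, ⟨by omega, hy0, ?_⟩, ?_⟩
      · rcases Nat.lt_or_ge e (y + 2) with h | h
        · have : e = y + 1 := by omega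
          subst this
          exact h5.le
        · rw [hz (y + 1) le_rfl (by omega)]; simp
      · rcases Nat.lt_or_ge e (y + 2) with h | h
        · have : e = y + 1 := by omega
          subst this
          have : pp c l (y + 1) ≠ 0 := by rintro h; simp [h] at h5
          simp [F, this]
        · have : e = y + 2 := by omega
          subst this
          simp [F, hz (y + 1) le_rfl (by omega)]
    · rintro ⟨y, ⟨hy, hn⟩, hF⟩
      have hy1 : 1 ≤ y := by
        by_contra! h
        have : y = 0 := by omega
        subst this
        exact not_node_zero c l hn
      by_cases hz : pp c l (y + 1) = 0
      · have hyN : y + 2 ≤ N - 1 := by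
          by_contra! h
          have : N = y + 1 + 1 := by omega
          exact pp_no_consec c l _ hz (this ▸ hp)
        simp only [F, if_pos hz, Prod.mk.injEq] at hF
        obtain ⟨rfl, rfl⟩ := hF
        refine ⟨by omega, by omega, hyN, ?_, ?_⟩
        · intro x hx
          simp only [Finset.mem_Icc] at hx
          obtain rfl | rfl : x = y + 1 ∨ x = y + 1 + 1 := by omega
          · rfl
          · exact (hdz (y + 1) (by omega) (by omega)).2 hz
        · rw [show y + 1 - 1 = y by omega, hdd y (y + 2) hy1 (by omega) (by omega) hyN, pp_ss, hz]
          have := mul_self_pos.2 hn.1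
          linarith
      · simp only [F, if_neg hz, Prod.mk.injEq] at hF
        obtain ⟨rfl, rfl⟩ := hF
        refine ⟨by omega, by omega, by omega, ?_, ?_⟩
        · intro x hx
          simp only [Finset.mem_Icc] at hx
          obtain rfl : x = y + 1 := by omega
          rfl
        · rw [show y + 1 - 1 = y by omega, hdd y (y + 1) hy1 (by omega) (by omega) (by omega)]
          exact lt_of_le_of_ne hn.2 (mul_ne_zero hn.1 hz)
  rw [hset, Set.ncard_coe_finset, Finset.card_image_of_injective _ hF]
  rfl

/-- For `2 ≤ j ≤ N − 1`, any eigenfunction of `−Δ^c` for the eigenvalue `λ_j` is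
`j`-monotone: it has exactly `j − 1` local extrema in `⟦2, N−1⟧`. -/
theorem eigenfunction_j_monotone (N : ℕ) (hN : 2 ≤ N) (c : ℕ → ℝ)
    (hc : ∀ x, 1 ≤ x → x ≤ N - 1 → 0 < c x)
    (lam : ℕ → ℝ) (hlam0 : lam 0 = 0)
    (hmono : ∀ i j, i < j → j < N → lam i < lam j)
    (hchar : ∀ μ : ℝ, IsEigenvalue N c μ ↔ ∃ i < N, μ = lam i)
    (j : ℕ) (hj : 2 ≤ j) (hj' : j ≤ N - 1)
    (g : ℕ → ℝ) (hg0 : ∃ x ∈ Finset.Icc 1 N, g x ≠ 0)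
    (hg : ∀ x ∈ Finset.Icc 1 N, gen N c g x = -(lam j) * g x) :
    {p : ℕ × ℕ | AdmitsLocalExtremum N g p.1 p.2}.ncard = j - 1 := by
  have hpos : ∀ i, 1 ≤ i → i < N → lam i ≠ 0 := by
    intro i h1 h2
    have := hmono 0 i (by omega) h2
    rw [hlam0] at this
    exact this.ne'
  have hroot : ∀ i, 1 ≤ i → i < N → pp c (lam i) N = 0 := by
    intro i h1 h2
    obtain ⟨f, hf0, hf⟩ := (hchar (lam i)).2 ⟨i, h2, rfl⟩
    obtain ⟨k, _, _, h⟩ := flux N hN c hc (lam i) (hpos i h1 h2) f hf0 hf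
    exact h
  have hst : ∀ i, 1 ≤ i → i + 1 < N → cnt c (lam i) (N - 1) < cnt c (lam (i + 1)) (N - 1) :=
    fun i h1 h2 => sturm_strict (hmono i (i + 1) (by omega) h2) N hN hc
      (hroot i h1 (by omega)) (hroot (i + 1) (by omega) h2)
  have hchain : ∀ d i, 1 ≤ i → i + d < N →
      cnt c (lam i) (N - 1) + d ≤ cnt c (lam (i + d)) (N - 1) := by
    intro d
    induction d with
    | zero => intro i _ _; simp
    | succ d ih =>
      intro i h1 h2
      have a := ih i h1 (by omega)
      have b := hst (i + d) (by omega) (by omega)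
      rw [← Nat.add_assoc i d 1]
      omega
  obtain ⟨k, hk, hf, hp⟩ := flux N hN c hc (lam j) (hpos j (by omega) (by omega)) g hg0 hg
  rw [count_ext N hN c hc (lam j) k hk g hf hp]
  have lo := hchain (j - 1) 1 le_rfl (by omega)
  have hi := hchain (N - 1 - j) j (by omega) (by omega)
  rw [show 1 + (j - 1) = j by omega] at lo
  have up := cnt_le c (lam (j + (N - 1 - j))) (N - 2)
  rw [show N - 2 + 1 = N - 1 by omega] at up
  omega
end

section
/- Let (c^(N))_{N≥2} be a family of conductances satisfying condition (LLN). Then lim_{N→∞} N²·gap_N / π² = 1, where gap_N is the spectral gap of Δ^{c^(N)}. -/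
open Filter Topology

/-- The spectral gap: the smallest strictly positive eigenvalue of `−Δ^c`. -/
noncomputable def spectralGap (N : ℕ) (c : ℕ → ℝ) : ℝ :=
  sInf {lam : ℝ | 0 < lam ∧ IsEigenvalue N c lam}

/-- `rsum r n m = Σ_{x=n}^{m-1} r(x)`. -/
def rsum (r : ℕ → ℝ) (n m : ℕ) : ℝ := ∑ x ∈ Finset.Ico n m, r x

/-- Condition (LLN): `(1/N)·sup_{1 ≤ n < m ≤ N} |r^{(N)}(n,m) − (m−n)| → 0`. -/
def LLN (r : ℕ → ℕ → ℝ) : Prop :=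
  ∀ ε > (0 : ℝ), ∃ N₀ : ℕ, ∀ N ≥ N₀, ∀ n m : ℕ, 1 ≤ n → n < m → m ≤ N →
    |rsum (r N) n m - ((m : ℝ) - (n : ℝ))| ≤ ε * N

lemma ga_parts (g : ℕ → ℝ) (h0 : g 0 = 0) (n : ℕ) :
    ∑ x ∈ Finset.range n, (g (x + 1) - g x) ^ 2
      = g n * (g n - g (n - 1))
        + ∑ x ∈ Finset.range n, g x * (2 * g x - g (x + 1) - g (x - 1)) := by
  induction n with
  | zero => simp [h0]
  | succ n ih =>
    rw [Finset.sum_range_succ, Finset.sum_range_succ, ih]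
    simp only [Nat.add_sub_cancel]
    ring

lemma ga_abel (r g : ℕ → ℝ) (h0 : g 0 = 0) (n : ℕ) :
    ∑ x ∈ Finset.range n, (r x - 1) * g x ^ 2
      = (rsum r 1 n - ((n : ℝ) - 1)) * g n ^ 2
        - ∑ x ∈ Finset.range n, (rsum r 1 (x + 1) - (x : ℝ)) * (g (x + 1) ^ 2 - g x ^ 2) := by
  induction n with
  | zero => simp [h0]
  | succ n ih =>
    rw [Finset.sum_range_succ, Finset.sum_range_succ, ih]
    rcases Nat.eq_zero_or_pos n with hn | hn
    · subst hn
      simp [h0, rsum]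
    · have : rsum r 1 (n + 1) = rsum r 1 n + r n := by
        unfold rsum
        rw [Finset.sum_Ico_succ_top hn]
      rw [this]
      push_cast
      ring

lemma ga_shift (g : ℕ → ℝ) (N : ℕ) (h0 : g 0 = 0) (hN : g N = 0) :
    ∑ x ∈ Finset.range N, g (x + 1) ^ 2 = ∑ x ∈ Finset.range N, g x ^ 2 := by
  have h1 := Finset.sum_range_succ (fun x => g x ^ 2) N
  have h2 := Finset.sum_range_succ' (fun x => g x ^ 2) N
  simp only [h0, hN] at h1 h2
  linarith

lemma ga_WS (r g : ℕ → ℝ) (N : ℕ) (hNpos : 1 ≤ N) (h0 : g 0 = 0) (hN : g N = 0) (ε : ℝ)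
    (hε : 0 < ε)
    (hr : ∀ m, 1 < m → m ≤ N → |rsum r 1 m - ((m : ℝ) - 1)| ≤ ε * N) :
    |∑ x ∈ Finset.range N, r x * g x ^ 2 - ∑ x ∈ Finset.range N, g x ^ 2|
      ≤ ε * ((N : ℝ) ^ 2 / 2 * ∑ x ∈ Finset.range N, (g (x + 1) - g x) ^ 2
        + 2 * ∑ x ∈ Finset.range N, g x ^ 2) := by
  have hNr : (0 : ℝ) < N := by exact_mod_cast hNpos
  have e1 : ∑ x ∈ Finset.range N, r x * g x ^ 2 - ∑ x ∈ Finset.range N, g x ^ 2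
      = - ∑ x ∈ Finset.range N, (rsum r 1 (x + 1) - (x : ℝ)) * (g (x + 1) ^ 2 - g x ^ 2) := by
    have := ga_abel r g h0 N
    rw [hN] at this
    rw [← Finset.sum_sub_distrib]
    simp only [sub_mul, one_mul] at this ⊢
    linarith
  rw [e1, abs_neg]
  refine (Finset.abs_sum_le_sum_abs _ _).trans ?_
  have e2 : ε * ((N : ℝ) ^ 2 / 2 * ∑ x ∈ Finset.range N, (g (x + 1) - g x) ^ 2
        + 2 * ∑ x ∈ Finset.range N, g x ^ 2)
      = ∑ x ∈ Finset.range N, ε * ((N : ℝ) ^ 2 / 2 * (g (x + 1) - g x) ^ 2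
        + (g (x + 1) ^ 2 + g x ^ 2)) := by
    rw [← Finset.mul_sum, Finset.sum_add_distrib, Finset.sum_add_distrib, ga_shift g N h0 hN,
      Finset.mul_sum]
    ring
  rw [e2]
  apply Finset.sum_le_sum
  intro x hx
  rw [Finset.mem_range] at hx
  rw [abs_mul]
  have hP : |rsum r 1 (x + 1) - (x : ℝ)| ≤ ε * N := by
    rcases Nat.eq_zero_or_pos x with h | h
    · subst h
      simp [rsum]
      positivity
    · have := hr (x + 1) (by omega) (by omega)
      push_cast at this
      simpa using this
  have hQ : (N : ℝ) * |g (x + 1) ^ 2 - g x ^ 2| ≤ (N : ℝ) ^ 2 / 2 * (g (x + 1) - g x) ^ 2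
        + (g (x + 1) ^ 2 + g x ^ 2) := by
    rw [← abs_of_pos hNr, ← abs_mul, abs_of_pos hNr, abs_le]
    constructor
    · nlinarith [sq_nonneg ((N : ℝ) * (g (x + 1) - g x) + (g (x + 1) + g x)),
        sq_nonneg (g (x + 1) - g x)]
    · nlinarith [sq_nonneg ((N : ℝ) * (g (x + 1) - g x) - (g (x + 1) + g x)),
        sq_nonneg (g (x + 1) - g x)]
  calc _ ≤ ε * N * |g (x + 1) ^ 2 - g x ^ 2| := by gcongr
    _ = ε * (N * |g (x + 1) ^ 2 - g x ^ 2|) := by ring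
    _ ≤ _ := by gcongr

noncomputable def gaS (N : ℕ) (x : ℕ) : ℝ := Real.sin (x * (Real.pi / N))

noncomputable def gaL (N : ℕ) : ℝ := 2 - 2 * Real.cos (Real.pi / N)

lemma gaS_zero (N : ℕ) : gaS N 0 = 0 := by simp [gaS]

lemma gaS_N (N : ℕ) (hN : 1 ≤ N) : gaS N N = 0 := by
  have : (N : ℝ) ≠ 0 := by positivity
  unfold gaS
  rw [mul_div_cancel₀ _ this, Real.sin_pi]

lemma gaS_pos (N x : ℕ) (h1 : 1 ≤ x) (h2 : x < N) : 0 < gaS N x := by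
  have hx : (0 : ℝ) < x := by exact_mod_cast h1
  have hxN : (x : ℝ) < N := by exact_mod_cast h2
  have hN : (0 : ℝ) < N := hx.trans hxN
  apply Real.sin_pos_of_pos_of_lt_pi
  · positivity
  · rw [mul_div_assoc', div_lt_iff₀ hN, mul_comm]
    exact mul_lt_mul_of_pos_left hxN Real.pi_pos

lemma gaS_eq (N x : ℕ) (h1 : 1 ≤ x) :
    2 * gaS N x - gaS N (x + 1) - gaS N (x - 1) = gaL N * gaS N x := by
  obtain ⟨y, rfl⟩ : ∃ y, x = y + 1 := ⟨x - 1, by omega⟩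
  simp only [Nat.add_sub_cancel]
  unfold gaS gaL
  set t := Real.pi / N
  have a : ((y + 1 + 1 : ℕ) : ℝ) * t = ((y + 1 : ℕ) : ℝ) * t + t := by push_cast; ring
  have b : (y : ℝ) * t = ((y + 1 : ℕ) : ℝ) * t - t := by push_cast; ring
  rw [a, b, Real.sin_add, Real.sin_sub]
  ring

lemma gaL_pos (N : ℕ) (hN : 2 ≤ N) : 0 < gaL N := by
  have hN' : (2 : ℝ) ≤ N := by exact_mod_cast hN
  have h1 : 0 < Real.pi / N := by positivity
  have h2 : Real.pi / N ≤ Real.pi := div_le_self Real.pi_pos.le (by linarith)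
  have := Real.cos_lt_cos_of_nonneg_of_le_pi le_rfl h2 h1
  rw [Real.cos_zero] at this
  unfold gaL
  linarith

lemma gaL_le (N : ℕ) (hN : 1 ≤ N) : (N : ℝ) ^ 2 * gaL N ≤ Real.pi ^ 2 := by
  have hN' : (0 : ℝ) < N := by exact_mod_cast hN
  have := Real.one_sub_sq_div_two_le_cos (x := Real.pi / N)
  have h : gaL N ≤ (Real.pi / N) ^ 2 := by unfold gaL; linarith
  rw [div_pow, le_div_iff₀ (by positivity)] at h
  linarith

lemma gaL_tendsto : Tendsto (fun N : ℕ => (N : ℝ) ^ 2 * gaL N / Real.pi ^ 2) atTop (nhds 1) := by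
  rw [tendsto_iff_dist_tendsto_zero]
  have hlim : Tendsto (fun N : ℕ => (Real.pi ^ 2) * ((1 : ℝ) / N)) atTop (nhds 0) := by
    simpa using (tendsto_one_div_atTop_nhds_zero_nat (𝕜 := ℝ)).const_mul (Real.pi ^ 2)
  refine squeeze_zero' (Eventually.of_forall fun _ => dist_nonneg) ?_ hlim
  filter_upwards [eventually_ge_atTop 4] with N hN
  have hN' : (4 : ℝ) ≤ N := by exact_mod_cast hN
  have hNp : (0 : ℝ) < N := by linarith
  have hpi := Real.pi_pos
  have hpi4 := Real.pi_le_four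
  set t := Real.pi / N with ht
  have ht0 : 0 < t := by positivity
  have ht1 : |t| ≤ 1 := by
    rw [abs_of_pos ht0, ht, div_le_one hNp]; linarith
  have hb := Real.cos_bound ht1
  rw [abs_of_pos ht0] at hb
  have hNt : (N : ℝ) = Real.pi / t := by rw [ht]; field_simp
  rw [Real.dist_eq]
  have e : (N : ℝ) ^ 2 * gaL N / Real.pi ^ 2 - 1
      = -2 / t ^ 2 * (Real.cos t - (1 - t ^ 2 / 2)) := by
    unfold gaL
    rw [← ht, hNt]
    field_simp
    ring
  rw [e, abs_mul, abs_div, abs_neg, abs_two, abs_of_pos (show 0 < t ^ 2 by positivity)]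
  have h1 : 2 / t ^ 2 * |Real.cos t - (1 - t ^ 2 / 2)| ≤ 2 / t ^ 2 * (t ^ 4 * (5 / 96)) := by
    gcongr
  have h2 : 2 / t ^ 2 * (t ^ 4 * (5 / 96)) = t ^ 2 * (5 / 48) := by field_simp; norm_num
  have h3 : t ^ 2 ≤ t := by
    rw [abs_of_pos ht0] at ht1; nlinarith
  have h4 : t ≤ Real.pi ^ 2 * (1 / N) := by
    rw [ht, div_eq_mul_one_div]
    gcongr
    nlinarith [Real.pi_gt_three]
  linarith

lemma ga_picone (a b s t : ℝ) (hs : 0 < s) (ht : 0 < t) :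
    a ^ 2 * (1 - t / s) + b ^ 2 * (1 - s / t) ≤ (a - b) ^ 2 := by
  have : 0 ≤ (a * t - b * s) ^ 2 / (s * t) := by positivity
  have e : (a - b) ^ 2 - (a ^ 2 * (1 - t / s) + b ^ 2 * (1 - s / t))
      = (a * t - b * s) ^ 2 / (s * t) := by
    field_simp
    ring
  linarith

lemma ga_poincare (g : ℕ → ℝ) (N : ℕ) (hN2 : 2 ≤ N) (h0 : g 0 = 0) (hN : g N = 0) :
    gaL N * ∑ x ∈ Finset.range N, g x ^ 2 ≤ ∑ x ∈ Finset.range N, (g (x + 1) - g x) ^ 2 := by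
  have key : ∑ x ∈ Finset.range N, (g (x + 1) ^ 2 * (1 - gaS N x / gaS N (x + 1))
      + g x ^ 2 * (1 - gaS N (x + 1) / gaS N x)) ≤
      ∑ x ∈ Finset.range N, (g (x + 1) - g x) ^ 2 := by
    apply Finset.sum_le_sum
    intro x hx
    rw [Finset.mem_range] at hx
    rcases Nat.eq_zero_or_pos x with h | h
    · subst h
      simp [h0, gaS_zero]
    · rcases Nat.lt_or_ge (x + 1) N with h' | h'
      · exact ga_picone _ _ _ _ (gaS_pos N _ (by omega) h') (gaS_pos N x h hx)
      · have : x + 1 = N := by omega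
        rw [this, hN, gaS_N N (by omega)]
        simp
  refine le_trans (le_of_eq ?_) key
  rw [Finset.sum_add_distrib]
  have sh : ∑ x ∈ Finset.range N, g (x + 1) ^ 2 * (1 - gaS N x / gaS N (x + 1))
      = ∑ x ∈ Finset.range N, g x ^ 2 * (1 - gaS N (x - 1) / gaS N x) := by
    have h1 := Finset.sum_range_succ (fun x => g x ^ 2 * (1 - gaS N (x - 1) / gaS N x)) N
    have h2 := Finset.sum_range_succ' (fun x => g x ^ 2 * (1 - gaS N (x - 1) / gaS N x)) N
    simp only [h0, hN, Nat.add_sub_cancel] at h1 h2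
    linarith
  rw [sh, ← Finset.sum_add_distrib, Finset.mul_sum]
  apply Finset.sum_congr rfl
  intro x hx
  rw [Finset.mem_range] at hx
  rcases Nat.eq_zero_or_pos x with h | h
  · subst h; simp [h0]
  · have := gaS_eq N x h
    have hp := gaS_pos N x h hx
    have e : gaL N = 2 - (gaS N (x + 1) + gaS N (x - 1)) / gaS N x := by
      field_simp; linarith
    rw [e]; ring

/-- The weighted sum is controlled by the Dirichlet form. -/
lemma ga_W (r g : ℕ → ℝ) (N : ℕ) (hN2 : 2 ≤ N) (h0 : g 0 = 0) (hN : g N = 0) (ε : ℝ)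
    (hε : 0 < ε)
    (hr : ∀ m, 1 < m → m ≤ N → |rsum r 1 m - ((m : ℝ) - 1)| ≤ ε * N) :
    gaL N * |∑ x ∈ Finset.range N, r x * g x ^ 2 - ∑ x ∈ Finset.range N, g x ^ 2|
      ≤ 7 * ε * ∑ x ∈ Finset.range N, (g (x + 1) - g x) ^ 2 := by
  have h1 := ga_WS r g N (by omega) h0 hN ε hε hr
  have h2 := ga_poincare g N hN2 h0 hN
  have h3 := gaL_le N (by omega)
  have hL := gaL_pos N hN2
  have hD : 0 ≤ ∑ x ∈ Finset.range N, (g (x + 1) - g x) ^ 2 :=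
    Finset.sum_nonneg fun _ _ => sq_nonneg _
  set D := ∑ x ∈ Finset.range N, (g (x + 1) - g x) ^ 2
  set S := ∑ x ∈ Finset.range N, g x ^ 2
  have hpi : Real.pi ^ 2 ≤ 10 := by
    nlinarith [Real.pi_lt_d2, Real.pi_pos]
  calc _ ≤ gaL N * (ε * ((N : ℝ) ^ 2 / 2 * D + 2 * S)) := by gcongr
    _ = ε * (((N : ℝ) ^ 2 * gaL N) * D / 2 + 2 * (gaL N * S)) := by ring
    _ ≤ ε * (10 * D / 2 + 2 * D) := by
        have : (N : ℝ) ^ 2 * gaL N ≤ 10 := h3.trans hpi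
        gcongr
    _ = _ := by ring

/-- Every positive eigenvalue is bounded below. -/
lemma ga_lower (N : ℕ) (c : ℕ → ℝ) (hN2 : 2 ≤ N) (hc : ∀ x, 1 ≤ x → x ≤ N - 1 → 0 < c x)
    (ε : ℝ) (hε : 0 < ε)
    (hr : ∀ m, 1 < m → m ≤ N → |rsum (fun x => 1 / c x) 1 m - ((m : ℝ) - 1)| ≤ ε * N)
    (lam : ℝ) (hl : 0 < lam) (he : IsEigenvalue N c lam) :
    gaL N ≤ lam * (1 + 7 * ε) := by
  obtain ⟨f, ⟨x0, hx0, hfx0⟩, hf⟩ := he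
  set g : ℕ → ℝ := fun x => if 1 ≤ x ∧ x < N then c x * (f (x + 1) - f x) else 0 with hg
  have h0 : g 0 = 0 := by simp [hg]
  have hN : g N = 0 := by simp [hg]
  have hgen : ∀ x, x < N → g (x + 1) - g x = -lam * f (x + 1) := by
    intro x hx
    rw [← hf (x + 1) (Finset.mem_Icc.2 ⟨by omega, by omega⟩)]
    simp only [hg, gen, Nat.add_sub_cancel]
    by_cases a : x + 1 < N <;> by_cases b : 1 ≤ x <;> simp [a, b, hx] <;> ring
  have hDpos : 0 < ∑ x ∈ Finset.range N, (g (x + 1) - g x) ^ 2 := by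
    rw [Finset.mem_Icc] at hx0
    apply Finset.sum_pos' (fun _ _ => sq_nonneg _)
    refine ⟨x0 - 1, Finset.mem_range.2 (by omega), ?_⟩
    rw [hgen _ (by omega), Nat.sub_add_cancel hx0.1]
    have : -lam * f x0 ≠ 0 := mul_ne_zero (by linarith) hfx0
    positivity
  have hDW : ∑ x ∈ Finset.range N, (g (x + 1) - g x) ^ 2
      = lam * ∑ x ∈ Finset.range N, (1 / c x) * g x ^ 2 := by
    rw [ga_parts g h0 N, hN, zero_mul, zero_add, Finset.mul_sum]
    apply Finset.sum_congr rfl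
    intro x hx
    rw [Finset.mem_range] at hx
    rcases Nat.eq_zero_or_pos x with h | h
    · subst h; simp [h0]
    · have a1 := hgen x hx
      have a2 := hgen (x - 1) (by omega)
      rw [Nat.sub_add_cancel h] at a2
      have a3 : g x = c x * (f (x + 1) - f x) := by simp [hg, hx]; intro h; omega
      have hcx := hc x h (by omega)
      have a4 : f (x + 1) - f x = 1 / c x * g x := by rw [a3]; field_simp
      have a5 : 2 * g x - g (x + 1) - g (x - 1) = lam * (f (x + 1) - f x) := by linarith
      rw [a5, a4]; ring
  have h1 := ga_W (fun x => 1 / c x) g N hN2 h0 hN ε hε hr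
  have h2 := ga_poincare g N hN2 h0 hN
  have hL := gaL_pos N hN2
  set D := ∑ x ∈ Finset.range N, (g (x + 1) - g x) ^ 2
  set S := ∑ x ∈ Finset.range N, g x ^ 2
  set W := ∑ x ∈ Finset.range N, (1 / c x) * g x ^ 2
  have h3 : gaL N * W ≤ (1 + 7 * ε) * D := by
    have := mul_le_mul_of_nonneg_left (le_abs_self (W - S)) hL.le
    nlinarith
  have h4 : gaL N * D ≤ lam * (1 + 7 * ε) * D := by
    calc gaL N * D = lam * (gaL N * W) := by rw [hDW]; ring
      _ ≤ lam * ((1 + 7 * ε) * D) := by gcongr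
      _ = _ := by ring
  exact le_of_mul_le_mul_right h4 hDpos

lemma ga_exists_min (N : ℕ) (r : ℕ → ℝ) (hN2 : 2 ≤ N) (hr : ∀ x, 1 ≤ x → x < N → 0 < r x) :
    ∃ g : ℕ → ℝ, g 0 = 0 ∧ g N = 0 ∧ 0 < ∑ x ∈ Finset.range N, r x * g x ^ 2 ∧
      ∀ h : ℕ → ℝ, h 0 = 0 → h N = 0 →
        (∑ x ∈ Finset.range N, (g (x + 1) - g x) ^ 2) * ∑ x ∈ Finset.range N, r x * h x ^ 2
        ≤ (∑ x ∈ Finset.range N, (h (x + 1) - h x) ^ 2) *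
          ∑ x ∈ Finset.range N, r x * g x ^ 2 := by
  set I : ℕ → Set ℝ := fun x => if 1 ≤ x ∧ x < N then Set.Icc (-1) 1 else {0} with hI
  set K : Set (ℕ → ℝ) := Set.pi Set.univ I ∩ {g | ∑ x ∈ Finset.range N, g x ^ 2 = 1} with hK
  have hKc : IsCompact K := by
    apply IsCompact.inter_right
    · apply isCompact_univ_pi
      intro x
      simp only [hI]
      split_ifs
      · exact isCompact_Icc
      · exact isCompact_singleton
    · exact isClosed_eq (by fun_prop) continuous_const
  have hzero : ∀ g ∈ K, ∀ x, ¬ (1 ≤ x ∧ x < N) → g x = 0 := by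
    intro g hg x hx
    have := hg.1 x (Set.mem_univ x)
    simp only [hI, if_neg hx] at this
    exact this
  have hWpos : ∀ g : ℕ → ℝ, g 0 = 0 → (∃ x ∈ Finset.range N, g x ≠ 0) →
      0 < ∑ x ∈ Finset.range N, r x * g x ^ 2 := by
    intro g h0 ⟨x, hx, hgx⟩
    apply Finset.sum_pos'
    · intro y hy
      rcases Nat.eq_zero_or_pos y with h | h
      · subst h; simp [h0]
      · have := hr y h (Finset.mem_range.1 hy)
        positivity
    · refine ⟨x, hx, ?_⟩
      have : 1 ≤ x := by
        rcases Nat.eq_zero_or_pos x with h | h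
        · subst h; exact absurd h0 hgx
        · exact h
      have := hr x this (Finset.mem_range.1 hx)
      positivity
  have hKW : ∀ g ∈ K, 0 < ∑ x ∈ Finset.range N, r x * g x ^ 2 := by
    intro g hg
    apply hWpos g (hzero g hg 0 (by omega))
    by_contra! hcon
    have h1 : ∑ x ∈ Finset.range N, g x ^ 2 = 1 := hg.2
    rw [Finset.sum_eq_zero (fun x hx => by rw [hcon x hx]; simp)] at h1
    exact zero_ne_one h1
  -- normalisation into K
  have hnorm : ∀ h : ℕ → ℝ, h 0 = 0 → h N = 0 → (∃ x ∈ Finset.range N, h x ≠ 0) →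
      ∃ k ∈ K, ∃ t : ℝ, t ≠ 0 ∧ ∀ x ≤ N, k x = t * h x := by
    intro h h0 hN ⟨x, hx, hhx⟩
    set S := ∑ x ∈ Finset.range N, h x ^ 2 with hS
    have hSpos : 0 < S := Finset.sum_pos' (fun _ _ => sq_nonneg _) ⟨x, hx, by positivity⟩
    have hsq : (1 / Real.sqrt S) ^ 2 = 1 / S := by
      rw [div_pow, one_pow, Real.sq_sqrt hSpos.le]
    refine ⟨fun x => if x ≤ N then 1 / Real.sqrt S * h x else 0, ⟨?_, ?_⟩, 1 / Real.sqrt S,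
      by positivity, fun x hx => by simp [hx]⟩
    · intro y _
      simp only [hI]
      by_cases hy1 : 1 ≤ y ∧ y < N <;> by_cases hy2 : y ≤ N <;> simp only [hy1, hy2, if_true, if_false, and_self]
      · rw [Set.mem_Icc, ← abs_le, ← sq_le_one_iff_abs_le_one, mul_pow, hsq]
        have : h y ^ 2 ≤ S := Finset.single_le_sum (f := fun x => h x ^ 2)
          (fun _ _ => sq_nonneg _) (Finset.mem_range.2 hy1.2)
        rw [one_div_mul_eq_div, div_le_one hSpos]
        exact this
      · omega
      · have : y = 0 ∨ y = N := by omega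
        rcases this with rfl | rfl <;> simp [h0, hN]
      · simp
    · show ∑ x ∈ Finset.range N, (if x ≤ N then 1 / Real.sqrt S * h x else 0) ^ 2 = 1
      have : ∀ x ∈ Finset.range N, (if x ≤ N then 1 / Real.sqrt S * h x else 0) ^ 2
          = 1 / S * h x ^ 2 := by
        intro x hx
        rw [if_pos (Finset.mem_range.1 hx).le, mul_pow, hsq]
      rw [Finset.sum_congr rfl this, ← Finset.mul_sum, ← hS]
      field_simp
  have hKne : K.Nonempty := by
    obtain ⟨k, hk, _⟩ := hnorm (gaS N) (gaS_zero N) (gaS_N N (by omega))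
      ⟨1, Finset.mem_range.2 (by omega), (gaS_pos N 1 le_rfl (by omega)).ne'⟩
    exact ⟨k, hk⟩
  obtain ⟨g, hgK, hmin⟩ := hKc.exists_isMinOn hKne
    (f := fun g : ℕ → ℝ => (∑ x ∈ Finset.range N, (g (x + 1) - g x) ^ 2)
      / ∑ x ∈ Finset.range N, r x * g x ^ 2)
    (ContinuousOn.div (by fun_prop) (by fun_prop) (fun g hg => (hKW g hg).ne'))
  refine ⟨g, hzero g hgK 0 (by omega), hzero g hgK N (by omega), hKW g hgK, ?_⟩
  intro h h0 hN
  by_cases hne : ∃ x ∈ Finset.range N, h x ≠ 0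
  · obtain ⟨k, hk, t, ht, hkt⟩ := hnorm h h0 hN hne
    have h1 := hmin hk
    simp only [Set.mem_ofPred_eq] at h1
    rw [div_le_div_iff₀ (hKW g hgK) (hKW k hk)] at h1
    have e1 : ∑ x ∈ Finset.range N, r x * k x ^ 2
        = t ^ 2 * ∑ x ∈ Finset.range N, r x * h x ^ 2 := by
      rw [Finset.mul_sum]
      apply Finset.sum_congr rfl
      intro x hx
      rw [hkt x (Finset.mem_range.1 hx).le]; ring
    have e2 : ∑ x ∈ Finset.range N, (k (x + 1) - k x) ^ 2
        = t ^ 2 * ∑ x ∈ Finset.range N, (h (x + 1) - h x) ^ 2 := by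
      rw [Finset.mul_sum]
      apply Finset.sum_congr rfl
      intro x hx
      rw [hkt x (Finset.mem_range.1 hx).le, hkt (x + 1) (Finset.mem_range.1 hx)]; ring
    rw [e1, e2] at h1
    have ht2 : 0 < t ^ 2 := by positivity
    nlinarith
  · push Not at hne
    have hz : ∑ x ∈ Finset.range N, r x * h x ^ 2 = 0 :=
      Finset.sum_eq_zero (fun x hx => by rw [hne x hx]; simp)
    rw [hz, mul_zero]
    exact mul_nonneg (Finset.sum_nonneg fun _ _ => sq_nonneg _) (hKW g hgK).le

lemma ga_quad (A B : ℝ) (h : ∀ t : ℝ, 0 ≤ A * t + B * t ^ 2) : A = 0 := by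
  by_contra hA
  have hB : 0 < |B| + 1 := by positivity
  have := h (-A / (2 * (|B| + 1)))
  have h2 : A * (-A / (2 * (|B| + 1))) + B * (-A / (2 * (|B| + 1))) ^ 2
      = A ^ 2 / (4 * (|B| + 1) ^ 2) * (B - 2 * (|B| + 1)) := by
    field_simp
    ring
  rw [h2] at this
  have h3 : 0 < A ^ 2 / (4 * (|B| + 1) ^ 2) := by positivity
  have h4 : B - 2 * (|B| + 1) < 0 := by
    have := le_abs_self B
    have := abs_nonneg B
    linarith
  nlinarith [mul_neg_of_pos_of_neg h3 h4]

/-- Existence of a positive eigenvalue bounded by any Rayleigh quotient. -/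
lemma ga_exists_eig (N : ℕ) (c : ℕ → ℝ) (hN2 : 2 ≤ N)
    (hc : ∀ x, 1 ≤ x → x ≤ N - 1 → 0 < c x) :
    ∃ lam : ℝ, 0 < lam ∧ IsEigenvalue N c lam ∧
      ∀ h : ℕ → ℝ, h 0 = 0 → h N = 0 →
        lam * ∑ x ∈ Finset.range N, (1 / c x) * h x ^ 2
        ≤ ∑ x ∈ Finset.range N, (h (x + 1) - h x) ^ 2 := by
  have hr : ∀ x, 1 ≤ x → x < N → 0 < 1 / c x := fun x h1 h2 =>
    one_div_pos.2 (hc x h1 (by omega))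
  obtain ⟨g, h0, hN, hW, hmin⟩ := ga_exists_min N (fun x => 1 / c x) hN2 hr
  set W := ∑ x ∈ Finset.range N, (1 / c x) * g x ^ 2 with hWdef
  set D := ∑ x ∈ Finset.range N, (g (x + 1) - g x) ^ 2 with hDdef
  have hgne : ∃ x ∈ Finset.range N, g x ≠ 0 := by
    by_contra! hcon
    rw [hWdef, Finset.sum_eq_zero (fun x hx => by rw [hcon x hx]; simp)] at hW
    exact lt_irrefl _ hW
  have hD : 0 < D := by
    have h2 := ga_poincare g N hN2 h0 hN
    obtain ⟨x, hx, hgx⟩ := hgne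
    have : 0 < ∑ x ∈ Finset.range N, g x ^ 2 :=
      Finset.sum_pos' (fun _ _ => sq_nonneg _) ⟨x, hx, by positivity⟩
    exact (mul_pos (gaL_pos N hN2) this).trans_le h2
  set lam := D / W with hlam
  have hlpos : 0 < lam := div_pos hD hW
  have hlW : lam * W = D := by rw [hlam]; field_simp
  have hR : ∀ h : ℕ → ℝ, h 0 = 0 → h N = 0 →
        lam * ∑ x ∈ Finset.range N, (1 / c x) * h x ^ 2
        ≤ ∑ x ∈ Finset.range N, (h (x + 1) - h x) ^ 2 := by
    intro h a b
    rw [hlam, div_mul_eq_mul_div, div_le_iff₀ hW]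
    exact hmin h a b
  -- Euler-Lagrange
  have hEL : ∀ y, 1 ≤ y → y < N → 2 * g y - g (y + 1) - g (y - 1) = lam * (1 / c y * g y) := by
    intro y hy1 hy2
    set d : ℕ → ℝ := fun x => if x = y then 1 else 0 with hd
    have d0 : d 0 = 0 := by simp [hd]; omega
    have dN : d N = 0 := by simp [hd]; omega
    have hQ : ∑ x ∈ Finset.range N, (g (x + 1) - g x) * (d (x + 1) - d x)
        = 2 * g y - g (y + 1) - g (y - 1) := by
      have e : ∀ x ∈ Finset.range N, (g (x + 1) - g x) * (d (x + 1) - d x)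
          = (if x = y - 1 then g (x + 1) - g x else 0)
            - (if x = y then g (x + 1) - g x else 0) := by
        intro x _
        have : (x + 1 = y) ↔ (x = y - 1) := by omega
        simp only [hd, this]
        split_ifs <;> ring
      rw [Finset.sum_congr rfl e, Finset.sum_sub_distrib, Finset.sum_ite_eq', Finset.sum_ite_eq',
        if_pos (Finset.mem_range.2 (by omega)), if_pos (Finset.mem_range.2 hy2),
        Nat.sub_add_cancel hy1]
      ring
    have hP : ∑ x ∈ Finset.range N, (1 / c x) * (g x * d x) = 1 / c y * g y := by
      have e : ∀ x ∈ Finset.range N, (1 / c x) * (g x * d x)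
          = if x = y then (1 / c x) * g x else 0 := by
        intro x _
        simp only [hd]
        split_ifs <;> ring
      rw [Finset.sum_congr rfl e, Finset.sum_ite_eq', if_pos (Finset.mem_range.2 hy2)]
    set Q := ∑ x ∈ Finset.range N, (g (x + 1) - g x) * (d (x + 1) - d x) with hQd
    set P := ∑ x ∈ Finset.range N, (1 / c x) * (g x * d x) with hPd
    have := ga_quad (2 * (Q - lam * P)) (∑ x ∈ Finset.range N, (d (x + 1) - d x) ^ 2
      - lam * ∑ x ∈ Finset.range N, (1 / c x) * d x ^ 2) (by
      intro t
      have h1 := hR (fun x => g x + t * d x) (by simp [h0, d0]) (by simp [hN, dN])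
      have e1 : ∑ x ∈ Finset.range N, (1 / c x) * (g x + t * d x) ^ 2
          = W + 2 * t * P + t ^ 2 * ∑ x ∈ Finset.range N, (1 / c x) * d x ^ 2 := by
        rw [hWdef, hPd, Finset.mul_sum, Finset.mul_sum, ← Finset.sum_add_distrib,
          ← Finset.sum_add_distrib]
        apply Finset.sum_congr rfl
        intros; ring
      have e2 : ∑ x ∈ Finset.range N, (g (x + 1) + t * d (x + 1) - (g x + t * d x)) ^ 2
          = D + 2 * t * Q + t ^ 2 * ∑ x ∈ Finset.range N, (d (x + 1) - d x) ^ 2 := by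
        rw [hDdef, hQd, Finset.mul_sum, Finset.mul_sum, ← Finset.sum_add_distrib,
          ← Finset.sum_add_distrib]
        apply Finset.sum_congr rfl
        intros; ring
      rw [e1, e2] at h1
      linarith)
    rw [← hQ, ← hP]
    linarith
  refine ⟨lam, hlpos, ?_, hR⟩
  refine ⟨fun x => g x - g (x - 1), ?_, ?_⟩
  · by_contra! hcon
    have hz : ∀ x, x ≤ N → g x = 0 := by
      intro x
      induction x with
      | zero => intro _; exact h0
      | succ n ih =>
        intro hn
        have := hcon (n + 1) (Finset.mem_Icc.2 ⟨by omega, hn⟩)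
        simp only [Nat.add_sub_cancel] at this
        rw [ih (by omega)] at this
        linarith
    obtain ⟨x, hx, hgx⟩ := hgne
    exact hgx (hz x (Finset.mem_range.1 hx).le)
  · intro x hx
    rw [Finset.mem_Icc] at hx
    have key : ∀ y, 1 ≤ y → y < N →
        c y * ((g (y + 1) - g y) - (g y - g (y - 1))) = -lam * g y := by
      intro y h1 h2
      have a := hEL y h1 h2
      have hcy := hc y h1 (by omega)
      have : (g (y + 1) - g y) - (g y - g (y - 1)) = -(lam * (1 / c y * g y)) := by linarith
      rw [this]
      field_simp
    have k1 : (if x < N then c x * ((g (x + 1) - g (x + 1 - 1)) - (g x - g (x - 1))) else 0)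
        = -lam * g x := by
      split_ifs with h
      · simpa using key x hx.1 h
      · have : x = N := by omega
        rw [this, hN]; simp
    have k2 : (if 2 ≤ x then c (x - 1) * ((g (x - 1) - g (x - 1 - 1)) - (g x - g (x - 1))) else 0)
        = lam * g (x - 1) := by
      split_ifs with h
      · have := key (x - 1) (by omega) (by omega)
        rw [Nat.sub_add_cancel hx.1] at this
        linarith
      · have : x - 1 = 0 := by omega
        rw [this, h0]; simp
    unfold gen
    simp only
    rw [k1, k2]
    ring

lemma ga_bounds (N : ℕ) (c : ℕ → ℝ) (hN2 : 2 ≤ N) (hc : ∀ x, 1 ≤ x → x ≤ N - 1 → 0 < c x)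
    (ε : ℝ) (hε : 0 < ε) (hε2 : 14 * ε ≤ 1)
    (hr : ∀ m, 1 < m → m ≤ N → |rsum (fun x => 1 / c x) 1 m - ((m : ℝ) - 1)| ≤ ε * N) :
    |spectralGap N c - gaL N| ≤ 14 * ε * gaL N := by
  have hL := gaL_pos N hN2
  obtain ⟨lam, hl, hle, hR⟩ := ga_exists_eig N c hN2 hc
  have hup : lam * (1 - 7 * ε) ≤ gaL N := by
    have s0 := gaS_zero N
    have sN := gaS_N N (by omega)
    have h1 := hR (gaS N) s0 sN
    have h2 := ga_W (fun x => 1 / c x) (gaS N) N hN2 s0 sN ε hε hr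
    have hDS : ∑ x ∈ Finset.range N, (gaS N (x + 1) - gaS N x) ^ 2
        = gaL N * ∑ x ∈ Finset.range N, gaS N x ^ 2 := by
      rw [ga_parts _ s0 N, sN, zero_mul, zero_add, Finset.mul_sum]
      apply Finset.sum_congr rfl
      intro x hx
      rcases Nat.eq_zero_or_pos x with h | h
      · subst h; simp [s0]
      · rw [gaS_eq N x h]; ring
    have hS : 0 < ∑ x ∈ Finset.range N, gaS N x ^ 2 :=
      Finset.sum_pos' (fun _ _ => sq_nonneg _) ⟨1, Finset.mem_range.2 (by omega), by
        have := gaS_pos N 1 le_rfl (by omega)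
        positivity⟩
    rw [hDS] at h1 h2
    set S := ∑ x ∈ Finset.range N, gaS N x ^ 2
    set W := ∑ x ∈ Finset.range N, (1 / c x) * gaS N x ^ 2
    have h3 : |W - S| ≤ 7 * ε * S := by
      have : gaL N * |W - S| ≤ gaL N * (7 * ε * S) := by linarith
      exact le_of_mul_le_mul_left this hL
    have h4 : (1 - 7 * ε) * S ≤ W := by
      have := (abs_le.1 h3).1
      linarith
    have h5 : lam * (1 - 7 * ε) * S ≤ gaL N * S := by
      calc lam * (1 - 7 * ε) * S = lam * ((1 - 7 * ε) * S) := by ring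
        _ ≤ lam * W := by gcongr
        _ ≤ _ := h1
    exact le_of_mul_le_mul_right h5 hS
  have hgle : spectralGap N c ≤ lam := by
    unfold spectralGap
    exact csInf_le ⟨0, fun x hx => hx.1.le⟩ ⟨hl, hle⟩
  have hglow : gaL N / (1 + 7 * ε) ≤ spectralGap N c := by
    unfold spectralGap
    refine le_csInf ⟨lam, hl, hle⟩ ?_
    intro mu hmu
    rw [div_le_iff₀ (by positivity)]
    exact ga_lower N c hN2 hc ε hε hr mu hmu.1 hmu.2
  rw [div_le_iff₀ (by positivity)] at hglow
  have hlam2 : lam ≤ 2 * gaL N := by nlinarith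
  rw [abs_le]
  constructor
  · nlinarith
  · nlinarith

/-- Under condition (LLN), `N²·gap_N / π² → 1`. -/
theorem gap_asymptotics (c : ℕ → ℕ → ℝ)
    (hc : ∀ N, 2 ≤ N → ∀ x, 1 ≤ x → x ≤ N - 1 → 0 < c N x)
    (hLLN : LLN (fun N x => 1 / c N x)) :
    Tendsto (fun N : ℕ => (N : ℝ) ^ 2 * spectralGap N (c N) / Real.pi ^ 2)
      atTop (nhds 1) := by
  have hz : Tendsto (fun N : ℕ => (N : ℝ) ^ 2 * spectralGap N (c N) / Real.pi ^ 2
      - (N : ℝ) ^ 2 * gaL N / Real.pi ^ 2) atTop (nhds 0) := by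
    rw [Metric.tendsto_atTop]
    intro δ hδ
    set ε := min (1 / 14) (δ / 28) with hεd
    have hε : 0 < ε := by positivity
    have he1 : ε ≤ 1 / 14 := min_le_left _ _
    have he2 : ε ≤ δ / 28 := min_le_right _ _
    obtain ⟨N₀, hN₀⟩ := hLLN ε hε
    refine ⟨max N₀ 2, fun N hN => ?_⟩
    have hNa : N₀ ≤ N := (le_max_left _ _).trans hN
    have hNb : 2 ≤ N := (le_max_right _ _).trans hN
    have hb := ga_bounds N (c N) hNb (hc N hNb) ε hε (by linarith) (by
      intro m h1 h2
      have := hN₀ N hNa 1 m le_rfl h1 h2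
      simpa using this)
    have hpi : (0 : ℝ) < Real.pi ^ 2 := by positivity
    rw [Real.dist_eq, sub_zero, ← sub_div, ← mul_sub, abs_div, abs_mul, abs_of_pos hpi,
      abs_of_nonneg (sq_nonneg (N : ℝ)), div_lt_iff₀ hpi]
    calc (N : ℝ) ^ 2 * |spectralGap N (c N) - gaL N| ≤ (N : ℝ) ^ 2 * (14 * ε * gaL N) := by gcongr
      _ = 14 * ε * ((N : ℝ) ^ 2 * gaL N) := by ring
      _ ≤ 14 * ε * Real.pi ^ 2 := by
          have := gaL_le N (by omega)
          gcongr
      _ < δ * Real.pi ^ 2 := by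
          apply mul_lt_mul_of_pos_right _ hpi
          linarith
  have := hz.add gaL_tendsto
  simpa using this
end

section
/- Let (c^(N))_{N≥2} be a family of conductances satisfying condition (LLN). For N ≥ 2 write the eigenvalues of −Δ^{c^(N)} as 0 = λ₀^(N) < λ₁^(N) < ⋯ < λ_{N−1}^(N). Then for every fixed integer j ≥ 1, lim_{N→∞} N²·λ_j^(N) / π² = j². -/
open Filter Topology

noncomputable def sol (ρ : ℕ → ℝ) (N : ℕ) (s : ℝ) : ℕ → ℝ × ℝ
  | 0 => (1, 0)
  | i + 1 => ((sol ρ N s i).1 + ρ i / N * ((sol ρ N s i).2 - s / N * (sol ρ N s i).1),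
      (sol ρ N s i).2 - s / N * (sol ρ N s i).1)

lemma sol_snd (ρ : ℕ → ℝ) (N : ℕ) (s : ℝ) (i : ℕ) :
    (sol ρ N s (i+1)).2 = (sol ρ N s i).2 - s / N * (sol ρ N s i).1 := rfl

lemma sol_fst (ρ : ℕ → ℝ) (N : ℕ) (s : ℝ) (i : ℕ) :
    (sol ρ N s (i+1)).1 = (sol ρ N s i).1 + ρ i / N * (sol ρ N s (i+1)).2 := rfl

lemma sol_cont (ρ : ℕ → ℝ) (N : ℕ) (i : ℕ) :
    Continuous (fun s => (sol ρ N s i).1) ∧ Continuous (fun s => (sol ρ N s i).2) := by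
  induction i with
  | zero => simp only [sol]; exact ⟨continuous_const, continuous_const⟩
  | succ i ih =>
    obtain ⟨h1, h2⟩ := ih
    simp only [sol]
    constructor <;> fun_prop

lemma sol_wronsk (ρ : ℕ → ℝ) (N : ℕ) (s t : ℝ) (i : ℕ) :
    (sol ρ N s i).2 * (sol ρ N t i).1 - (sol ρ N t i).2 * (sol ρ N s i).1
      = (t - s) / N * ∑ k ∈ Finset.range i, (sol ρ N s k).1 * (sol ρ N t k).1 := by
  induction i with
  | zero => simp [sol]
  | succ i ih =>
    rw [Finset.sum_range_succ, mul_add, ← ih]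
    simp only [sol]
    ring

lemma sol_orth (ρ : ℕ → ℝ) (N : ℕ) (s t : ℝ) (hN : 1 ≤ N) (hst : s ≠ t)
    (hs : (sol ρ N s N).2 = 0) (ht : (sol ρ N t N).2 = 0) :
    ∑ k ∈ Finset.range N, (sol ρ N s k).1 * (sol ρ N t k).1 = 0 := by
  have h := sol_wronsk ρ N s t N
  rw [hs, ht] at h
  simp only [zero_mul, sub_zero] at h
  have h2 : (t - s) / N ≠ 0 := by
    apply div_ne_zero (sub_ne_zero.2 hst.symm)
    have : N ≠ 0 := by omega
    exact_mod_cast this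
  rcases mul_eq_zero.1 h.symm with h | h
  · exact absurd h h2
  · exact h

lemma eig_iff (N : ℕ) (hN : 2 ≤ N) (c : ℕ → ℝ) (hc : ∀ x, 1 ≤ x → x ≤ N - 1 → 0 < c x) (lam : ℝ) :
    IsEigenvalue N c lam ↔ (sol (fun k => 1 / c (k+1)) N (N^2 * lam) N).2 = 0 := by
  have hN0 : (N:ℝ) ≠ 0 := by
    have : N ≠ 0 := by omega
    exact_mod_cast this
  obtain ⟨M, rfl⟩ : ∃ M, N = M + 2 := ⟨N - 2, by omega⟩
  set N := M + 2 with hNM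
  set ρ : ℕ → ℝ := fun k => 1 / c (k+1) with hρ
  have hs : (N:ℝ)^2 * lam / N = N * lam := by field_simp
  constructor
  · rintro ⟨f, ⟨y, hy, hfy⟩, hf⟩
    have key : ∀ i, i + 1 < N → f (i+2) = f 1 * (sol ρ N (N^2*lam) (i+1)).1 ∧
        f 1 * (sol ρ N (N^2*lam) (i+1)).2 = N * (c (i+1) * (f (i+2) - f (i+1))) ∧
        f (i+1) = f 1 * (sol ρ N (N^2*lam) i).1 := by
      intro i
      induction i with
      | zero =>
        intro hi
        have h1 := hf 1 (by simp; omega)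
        have hc1 := (hc 1 le_rfl (by omega)).ne'
        simp only [gen] at h1
        rw [if_pos (by omega), if_neg (by omega)] at h1
        have e : f 1 * (sol ρ N (N^2*lam) 1).2 = N * (c 1 * (f 2 - f 1)) := by
          rw [sol_snd, hs]; simp only [sol]
          norm_num at h1
          rw [h1]; ring
        refine ⟨?_, e, by simp [sol]⟩
        rw [sol_fst, mul_add, mul_left_comm, e]
        simp [sol, hρ]
        field_simp
        ring
      | succ i ih =>
        intro hi
        obtain ⟨a1, a2, a3⟩ := ih (by omega)
        have h1 := hf (i+2) (by simp; omega)
        have hc1 := (hc (i+2) (by omega) (by omega)).ne'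
        simp only [gen] at h1
        rw [if_pos (by omega), if_pos (by omega)] at h1
        have e3 : i + 2 - 1 = i + 1 := by omega
        rw [e3] at h1
        have e : f 1 * (sol ρ N (N^2*lam) (i+2)).2 = N * (c (i+2) * (f (i+3) - f (i+2))) := by
          rw [sol_snd, hs, mul_sub, a2, mul_left_comm (f 1), ← a1]
          have : c (i+2) * (f (i+3) - f (i+2)) = -lam * f (i+2) + c (i+1) * (f (i+2) - f (i+1)) := by
            linear_combination h1
          rw [this]; ring
        refine ⟨?_, e, a1⟩
        show f (i+3) = f 1 * (sol ρ N (N^2*lam) (i+2)).1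
        rw [sol_fst, mul_add, mul_left_comm, e, ← a1]
        simp only [hρ]
        field_simp
        ring
    have hf1 : f 1 ≠ 0 := by
      intro h0
      rw [Finset.mem_Icc] at hy
      rcases Nat.lt_or_ge y 2 with h | h
      · have : y = 1 := by omega
        subst this; exact hfy h0
      · obtain ⟨z, rfl⟩ : ∃ z, y = z + 2 := ⟨y - 2, by omega⟩
        apply hfy
        rw [(key z (by omega)).1, h0, zero_mul]
    obtain ⟨a1, a2, a3⟩ := key M (by omega)
    have h1 := hf (M+2) (by simp; omega)
    simp only [gen] at h1
    rw [if_neg (by omega), if_pos (by omega)] at h1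
    have e3 : M + 2 - 1 = M + 1 := by omega
    rw [e3] at h1
    have : f 1 * (sol ρ N (N^2*lam) (M+2)).2 = 0 := by
      rw [sol_snd, hs, mul_sub, a2, mul_left_comm (f 1), ← a1]
      linear_combination (-(N:ℝ)) * h1
    exact (mul_eq_zero.1 this).resolve_left hf1
  · intro h
    refine ⟨fun x => (sol ρ N (N^2*lam) (x-1)).1, ⟨1, by simp; omega, by simp [sol]⟩, ?_⟩
    have key : ∀ x, 1 ≤ x → x < N → c x * ((sol ρ N (N^2*lam) (x+1-1)).1 - (sol ρ N (N^2*lam) (x-1)).1)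
        = (sol ρ N (N^2*lam) x).2 / N := by
      intro x hx hxN
      obtain ⟨z, rfl⟩ : ∃ z, x = z + 1 := ⟨x - 1, by omega⟩
      have hc1 := (hc (z+1) (by omega) (by omega)).ne'
      simp only [Nat.add_sub_cancel]
      rw [sol_fst]
      simp only [hρ]
      field_simp
      ring
    have key2 : ∀ x, 1 ≤ x → (sol ρ N (N^2*lam) x).2 / N - (sol ρ N (N^2*lam) (x-1)).2 / N
        = -lam * (sol ρ N (N^2*lam) (x-1)).1 := by
      intro x hx
      obtain ⟨z, rfl⟩ : ∃ z, x = z + 1 := ⟨x - 1, by omega⟩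
      simp only [Nat.add_sub_cancel]
      rw [sol_snd, hs]
      field_simp
      ring
    intro x hx
    rw [Finset.mem_Icc] at hx
    simp only [gen]
    rw [← key2 x hx.1]
    have A : (if x < N then c x * ((sol ρ N (N^2*lam) (x+1-1)).1 - (sol ρ N (N^2*lam) (x-1)).1) else 0)
        = (sol ρ N (N^2*lam) x).2 / N := by
      split_ifs with h1
      · exact key x hx.1 h1
      · have : x = N := by omega
        rw [this, h, zero_div]
    have B : (if 2 ≤ x then c (x-1) * ((sol ρ N (N^2*lam) (x-1-1)).1 - (sol ρ N (N^2*lam) (x-1)).1) else 0)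
        = -((sol ρ N (N^2*lam) (x-1)).2 / N) := by
      split_ifs with h1
      · rw [← key (x-1) (by omega) (by omega)]
        have : x - 1 + 1 - 1 = x - 1 := by omega
        rw [this]; ring
      · have : x = 1 := by omega
        subst this; simp [sol]
    rw [A, B]; ring

lemma sin_step (x h : ℝ) (hh : 0 ≤ h) : |Real.sin (x+h) - Real.sin x - h * Real.cos x| ≤ h^2 := by
  have h1 : |Real.sin h - h| ≤ h^2/2 := by
    have a := Real.sin_le hh
    have b := Real.sin_ge_sub_cube hh
    have d := Real.neg_one_le_sin h
    rw [abs_le]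
    constructor
    · rcases le_total h 3 with h3 | h3
      · nlinarith [mul_nonneg (sq_nonneg h) (sub_nonneg.2 h3)]
      · nlinarith
    · nlinarith [sq_nonneg h]
  have h2 : |Real.cos h - 1| ≤ h^2/2 := by
    have := Real.one_sub_sq_div_two_le_cos (x := h)
    rw [abs_le]; constructor <;> nlinarith [Real.cos_le_one h]
  have e : Real.sin (x+h) - Real.sin x - h * Real.cos x
    = Real.sin x * (Real.cos h - 1) + Real.cos x * (Real.sin h - h) := by
    rw [Real.sin_add]; ring
  rw [e]
  calc _ ≤ |Real.sin x * (Real.cos h - 1)| + |Real.cos x * (Real.sin h - h)| := abs_add_le _ _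
    _ ≤ 1 * (h^2/2) + 1 * (h^2/2) := by
      rw [abs_mul, abs_mul]
      gcongr
      · exact Real.abs_sin_le_one x
      · exact Real.abs_cos_le_one x
    _ = h^2 := by ring

lemma cos_step (x h : ℝ) (hh : 0 ≤ h) : |Real.cos (x+h) - Real.cos x + h * Real.sin (x+h)| ≤ h^2 := by
  have h1 := sin_step (Real.pi/2 - (x+h)) h hh
  have e : Real.pi/2 - (x+h) + h = Real.pi/2 - x := by ring
  rw [e, Real.sin_pi_div_two_sub, Real.sin_pi_div_two_sub, Real.cos_pi_div_two_sub] at h1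
  rw [← abs_neg]
  convert h1 using 2
  ring

lemma core (ρ : ℕ → ℝ) (N : ℕ) (hN : 1 ≤ N) (w η ε : ℝ) (hw : 0 ≤ w) (hη : 0 ≤ η) (hε : 0 ≤ ε)
    (hε1 : ε ≤ 1)
    (hρ : ∀ k, k + 1 < N → 0 < ρ k)
    (hT : ∀ i, i < N → |∑ k ∈ Finset.range i, (ρ k - 1)| ≤ ε * N)
    (h1 : w^3 / N ≤ η) (h2 : ε * w ≤ η) (h3 : ε * w^2 + w^2 / N ≤ η) :
    (∀ i, i < N → |(sol ρ N (w^2) i).1 - Real.cos (w / N * i)| ≤ 4 * η * Real.exp (2 * w^2)) ∧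
    (∀ i, i ≤ N → |(sol ρ N (w^2) i).2 + w * Real.sin (w / N * i)|
      ≤ η + w^2 * (4 * η * Real.exp (2 * w^2))) := by
  have hNp : (0:ℝ) < N := by exact_mod_cast hN
  set T : ℕ → ℝ := fun i => ∑ k ∈ Finset.range i, (ρ k - 1) with hTdef
  set A : ℕ → ℝ := fun i => (∑ k ∈ Finset.range i, ρ k) / N with hA
  set B : ℕ → ℝ := fun i => 4 * η * Real.exp (w^2 * A i) with hB
  set S : ℕ → ℝ := fun i => - (w * Real.sin (w / N * i)) with hS
  set e : ℕ → ℝ := fun i => (sol ρ N (w^2) i).1 - Real.cos (w / N * i) with he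
  set d : ℕ → ℝ := fun i => (sol ρ N (w^2) i).2 - S i with hd
  have hA2 : ∀ i, i < N → A i ≤ 2 := by
    intro i hi
    have h := (abs_le.1 (hT i hi)).2
    simp only [Finset.sum_sub_distrib, Finset.sum_const, Finset.card_range, nsmul_eq_mul, mul_one] at h
    have hi' : (i:ℝ) ≤ N := by exact_mod_cast hi.le
    simp only [hA]
    rw [div_le_iff₀ hNp]
    nlinarith
  have hBle : ∀ i, i < N → B i ≤ 4 * η * Real.exp (2 * w^2) := by
    intro i hi
    have := hA2 i hi
    simp only [hB]
    rw [mul_comm 2 (w^2)]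
    gcongr
  have hB0 : ∀ i, 0 ≤ B i := fun i => by simp only [hB]; positivity
  have hAs : ∀ i, A (i+1) = A i + ρ i / N := by
    intro i; simp only [hA, Finset.sum_range_succ]; ring
  have hTs : ∀ i, T (i+1) = T i + (ρ i - 1) := by
    intro i; simp only [hTdef, Finset.sum_range_succ]
  have hBs : ∀ i, i + 1 < N → B i + w^2 * (ρ i / N) * B i ≤ B (i+1) := by
    intro i hi
    simp only [hB]
    rw [hAs, mul_add, Real.exp_add]
    have := Real.add_one_le_exp (w^2 * (ρ i / N))
    have h0 : 0 ≤ 4 * η * Real.exp (w^2 * A i) := by positivity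
    nlinarith
  have hang : ∀ i : ℕ, w / N * ((i+1 : ℕ):ℝ) = w / N * i + w / N := by
    intro i; push_cast; ring
  have hh : 0 ≤ w / N := by positivity
  have hSs : ∀ i, |S (i+1) - S i + w^2 / N * Real.cos (w / N * i)| ≤ η / N := by
    intro i
    have h := sin_step (w / N * i) (w/N) hh
    have e1 : S (i+1) - S i + w^2 / N * Real.cos (w / N * i) =
      -(w * (Real.sin (w / N * i + w / N) - Real.sin (w / N * i) - w / N * Real.cos (w / N * i))) := by
      simp only [hS]; rw [hang]; ring
    rw [e1, abs_neg, abs_mul, abs_of_nonneg hw]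
    calc _ ≤ w * (w/N)^2 := by gcongr
      _ = (w^3/N) / N := by ring
      _ ≤ η / N := by gcongr
  have hCs : ∀ i : ℕ, |Real.cos (w / N * (i+1 : ℕ)) - Real.cos (w / N * i) - S (i+1) / N| ≤ w^2 / N / N := by
    intro i
    have h := cos_step (w / N * i) (w/N) hh
    simp only [hS]; rw [hang]
    convert h using 1
    · congr 1; ring
    · ring
  have hSd : ∀ i, |S (i+1) - S i| ≤ w^2 / N := by
    intro i
    have e1 : S (i+1) - S i = -(w * (Real.sin (w / N * i + w / N) - Real.sin (w / N * i))) := by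
      simp only [hS]; rw [hang]; ring
    rw [e1, abs_neg, abs_mul, abs_of_nonneg hw]
    have := Real.abs_sin_sub_sin_le (w / N * i + w / N) (w / N * i)
    rw [add_sub_cancel_left, abs_of_nonneg hh] at this
    calc _ ≤ w * (w/N) := by gcongr
      _ = _ := by ring
  have hSb : ∀ i, |S i| ≤ w := by
    intro i
    simp only [hS]
    rw [abs_neg, abs_mul, abs_of_nonneg hw]
    have := Real.abs_sin_le_one (w / N * i)
    nlinarith
  have hTS : ∀ i, i < N → |T i / N * S i| ≤ η := by
    intro i hi
    have h := hT i hi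
    rw [abs_mul, abs_div, abs_of_pos hNp]
    calc _ ≤ (ε * N) / N * w := by gcongr; exact hSb i
      _ = ε * w := by field_simp
      _ ≤ η := h2
  have hTd : ∀ i, i < N → |T i / N * (S (i+1) - S i)| ≤ ε * w^2 / N := by
    intro i hi
    have h := hT i hi
    rw [abs_mul, abs_div, abs_of_pos hNp]
    calc _ ≤ (ε * N) / N * (w^2/N) := by gcongr; exact hSd i
      _ = _ := by field_simp
  have hds : ∀ i, |d (i+1)| ≤ |d i| + w^2 / N * |e i| + η / N := by
    intro i
    have e1 : d (i+1) = d i + -(w^2/N * e i) + -(S (i+1) - S i + w^2 / N * Real.cos (w / N * i)) := by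
      simp only [hd, he]; rw [sol_snd]; ring
    rw [e1]
    have := hSs i
    calc _ ≤ |d i| + |-(w^2/N * e i)| + |-(S (i+1) - S i + w^2 / N * Real.cos (w / N * i))| := abs_add_three _ _ _
      _ ≤ _ := by
        rw [abs_neg, abs_neg, abs_mul, abs_of_nonneg (by positivity : 0 ≤ w^2/N)]
        gcongr
  have hes : ∀ i, i + 1 < N → |e (i+1) - T (i+1) / N * S (i+1)| ≤
      |e i - T i / N * S i| + ρ i / N * |d (i+1)| + η / N := by
    intro i hi
    have e1 : e (i+1) - T (i+1) / N * S (i+1) = (e i - T i / N * S i) + ρ i / N * d (i+1)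
      + -(T i / N * (S (i+1) - S i)) + -(Real.cos (w / N * (i+1 : ℕ)) - Real.cos (w / N * i) - S (i+1) / N) := by
      simp only [hd, he]; rw [sol_fst, hTs]; ring
    rw [e1]
    have a := hTd i (by omega)
    have b := hCs i
    have hp := hρ i hi
    have c3 : ε * w^2 / N + w^2 / N / N ≤ η / N := by
      rw [← add_div]; gcongr
    calc _ ≤ |e i - T i / N * S i| + |ρ i / N * d (i+1)|
      + |-(T i / N * (S (i+1) - S i))| + |-(Real.cos (w / N * (i+1 : ℕ)) - Real.cos (w / N * i) - S (i+1) / N)| := by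
          refine (abs_add_le _ _).trans ?_
          gcongr
          exact abs_add_three _ _ _
      _ ≤ _ := by
        rw [abs_neg, abs_neg, abs_mul (ρ i / N), abs_of_nonneg (by positivity : 0 ≤ ρ i/N)]
        linarith
  -- e bound from tilde bound
  have heb : ∀ i, i < N → |e i - T i / N * S i| ≤ η * (i / N) + η * A i + (B i - 4 * η) → |e i| ≤ B i := by
    intro i hi h
    have a := hTS i hi
    have hi' : (i:ℝ) / N ≤ 1 := by rw [div_le_one hNp]; exact_mod_cast hi.le
    have b := hA2 i hi
    have : |e i| ≤ |e i - T i / N * S i| + |T i / N * S i| := by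
      have := abs_add_le (e i - T i / N * S i) (T i / N * S i)
      simpa using this
    nlinarith
  have hdstep : ∀ i, i < N → |d i| ≤ (i / N) * (η + w^2 * B i) → |e i| ≤ B i →
      |d (i+1)| ≤ ((i+1 : ℕ) / N) * (η + w^2 * B i) := by
    intro i hi a b
    have h := hds i
    have : w^2 / N * |e i| ≤ w^2 / N * B i := by gcongr
    push_cast
    calc _ ≤ (i / N) * (η + w^2 * B i) + w^2 / N * B i + η / N := by linarith
      _ = _ := by ring
  have inv : ∀ i, i < N → |d i| ≤ (i / N) * (η + w^2 * B i) ∧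
      |e i - T i / N * S i| ≤ η * (i / N) + η * A i + (B i - 4 * η) := by
    intro i
    induction i with
    | zero =>
      intro _
      simp [hd, he, hB, hA, hTdef, hS, sol]
    | succ i ih =>
      intro hi
      obtain ⟨a, b⟩ := ih (by omega)
      have c1 := hdstep i (by omega) a (heb i (by omega) b)
      have hp := hρ i hi
      have hi1 : ((i+1 : ℕ):ℝ) / N ≤ 1 := by rw [div_le_one hNp]; exact_mod_cast hi.le
      have hBi := hBs i hi
      have hB0i := hB0 i
      have hmon : B i ≤ B (i+1) := by
        have : 0 ≤ w^2 * (ρ i / N) * B i := by positivity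
        linarith
      constructor
      · refine c1.trans ?_
        gcongr
      · refine (hes i hi).trans ?_
        have c2 : |d (i+1)| ≤ η + w^2 * B i := by
          refine c1.trans ?_
          have : 0 ≤ η + w^2 * B i := by positivity
          nlinarith
        have c3 : ρ i / N * |d (i+1)| ≤ ρ i / N * (η + w^2 * B i) := by gcongr
        rw [hAs]
        have c4 : η * (((i+1 : ℕ):ℝ) / N) = η * (i / N) + η / N := by push_cast; ring
        rw [c4]
        nlinarith
  constructor
  · intro i hi
    exact (heb i hi (inv i hi).2).trans (hBle i hi)
  · intro i hi
    have e1 : (sol ρ N (w^2) i).2 + w * Real.sin (w / N * i) = d i := by simp only [hd, hS]; ring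
    rw [e1]
    rcases i with _ | i
    · simp [hd, hS, sol]; positivity
    · have hlt : i < N := by omega
      have c1 := hdstep i hlt (inv i hlt).1 (heb i hlt (inv i hlt).2)
      have hi1 : ((i+1 : ℕ):ℝ) / N ≤ 1 := by rw [div_le_one hNp]; exact_mod_cast hi
      have hB0i := hB0 i
      have h0 : 0 ≤ η + w^2 * B i := by positivity
      have h5 := hBle i hlt
      have h6 : w^2 * B i ≤ w^2 * (4 * η * Real.exp (2 * w^2)) := by gcongr
      nlinarith

lemma approx (c : ℕ → ℕ → ℝ)
    (hc : ∀ N, 2 ≤ N → ∀ x, 1 ≤ x → x ≤ N - 1 → 0 < c N x)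
    (hLLN : LLN (fun N x => 1 / c N x)) (W ε : ℝ) (hε : 0 < ε) :
    ∃ N₀ : ℕ, ∀ N ≥ N₀, 2 ≤ N ∧ ∀ w, 0 ≤ w → w ≤ W →
    (∀ i, i < N → |(sol (fun k => 1 / c N (k+1)) N (w^2) i).1 - Real.cos (w / N * i)| ≤ ε) ∧
    (∀ i, i ≤ N → |(sol (fun k => 1 / c N (k+1)) N (w^2) i).2 + w * Real.sin (w / N * i)| ≤ ε) := by
  set V := max W 1 with hV
  have hV1 : 1 ≤ V := le_max_right _ _
  set K := 1 + (1 + V^2) * (4 * Real.exp (2 * V^2)) with hK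
  have hK0 : 0 < K := by positivity
  set η := ε / K with hη
  have hη0 : 0 < η := by positivity
  set δ := min 1 (η / (2 * V^3)) with hδ
  have hδ0 : 0 < δ := by positivity
  obtain ⟨N₁, hN₁⟩ := hLLN δ hδ0
  obtain ⟨N₂, hN₂⟩ := exists_nat_ge (2 * V^3 / η)
  refine ⟨max (max N₁ N₂) 2, fun N hN => ?_⟩
  have hNa : N₁ ≤ N := le_trans (le_trans (le_max_left _ _) (le_max_left _ _)) hN
  have hNb : N₂ ≤ N := le_trans (le_trans (le_max_right _ _) (le_max_left _ _)) hN
  have hNc : 2 ≤ N := le_trans (le_max_right _ _) hN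
  refine ⟨hNc, fun w hw hwW => ?_⟩
  have hNp : (0:ℝ) < N := by positivity
  have hwV : w ≤ V := hwW.trans (le_max_left _ _)
  have hV0 : 0 < V := by linarith
  have hVN : V^3 / N ≤ η / 2 := by
    have h : 2 * V^3 / η ≤ N := hN₂.trans (by exact_mod_cast hNb)
    rw [div_le_iff₀ hη0] at h
    rw [div_le_iff₀ hNp]; nlinarith
  have hδV : δ * V^3 ≤ η / 2 := by
    calc _ ≤ (η / (2 * V^3)) * V^3 := by gcongr; exact min_le_right _ _
      _ = _ := by field_simp
  have hw2 : w^2 ≤ V^3 := by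
    calc w^2 ≤ V^2 := by gcongr
      _ ≤ V^3 := pow_le_pow_right₀ hV1 (by norm_num)
  have hw1 : w ≤ V^3 := hwV.trans (le_self_pow₀ hV1 (by norm_num))
  have hw3 : w^3 ≤ V^3 := by gcongr
  have := core (fun k => 1 / c N (k+1)) N (by omega) w η δ hw hη0.le hδ0.le (min_le_left _ _)
    (fun k hk => one_div_pos.2 (hc N hNc (k+1) (by omega) (by omega)))
    (by
      intro i hi
      rcases Nat.eq_zero_or_pos i with rfl | hi0
      · simp; positivity
      · have h := hN₁ N hNa 1 (i+1) le_rfl (by omega) (by omega)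
        simp only [rsum, Finset.sum_Ico_eq_sum_range] at h
        rw [Finset.sum_sub_distrib]
        simp only [Nat.add_sub_cancel, Nat.cast_add, Nat.cast_one, add_sub_cancel_right] at h
        simpa [add_comm] using h)
    (by
      calc w^3/N ≤ V^3 / N := by gcongr
        _ ≤ η := by linarith)
    (by
      calc δ * w ≤ δ * V^3 := by gcongr
        _ ≤ η := by linarith)
    (by
      have a : δ * w^2 ≤ δ * V^3 := by gcongr
      have b : w^2 / N ≤ V^3 / N := by gcongr
      linarith)
  have e1 : Real.exp (2 * w^2) ≤ Real.exp (2 * V^2) := by gcongr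
  have e2 : η * K = ε := by simp only [hη]; field_simp
  have x0 : 0 < Real.exp (2 * V^2) := Real.exp_pos _
  have b1 : 4 * η * Real.exp (2 * w^2) ≤ ε := by
    rw [← e2, hK]
    have : η * Real.exp (2 * w^2) ≤ η * Real.exp (2*V^2) := by gcongr
    have : 0 ≤ η * (V^2 * Real.exp (2*V^2)) := by positivity
    nlinarith
  have b2 : η + w^2 * (4 * η * Real.exp (2 * w^2)) ≤ ε := by
    rw [← e2, hK]
    have : w^2 * (4 * η * Real.exp (2 * w^2)) ≤ V^2 * (4 * η * Real.exp (2 * V^2)) := by gcongr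
    have : 0 ≤ η * Real.exp (2*V^2) := by positivity
    nlinarith
  exact ⟨fun i hi => (this.1 i hi).trans b1, fun i hi => (this.2 i hi).trans b2⟩

lemma cos_sum (h : ℝ) (hh : 0 ≤ h) (N : ℕ) :
    |h * ∑ i ∈ Finset.range N, Real.cos (h * i) - Real.sin (h * N)| ≤ N * h^2 := by
  induction N with
  | zero => simp
  | succ N ih =>
    rw [Finset.sum_range_succ]
    have e : h * ((N+1 : ℕ):ℝ) = h * N + h := by push_cast; ring
    rw [e]
    have s := sin_step (h * N) h hh
    rw [abs_le] at *
    push_cast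
    constructor <;> linarith [s.1, s.2, ih.1, ih.2]

lemma cos_sum_ge (k N : ℕ) (hN : 1 ≤ N) :
    -(2 * Real.pi * k) ≤ ∑ i ∈ Finset.range N, Real.cos (2 * Real.pi * k / N * i) := by
  rcases Nat.eq_zero_or_pos k with rfl | hk
  · simp
  have hNp : (0:ℝ) < N := by exact_mod_cast hN
  have hkp : (0:ℝ) < k := by exact_mod_cast hk
  have hp := Real.pi_pos
  set h := 2 * Real.pi * k / N with hh
  have hh0 : 0 < h := by positivity
  have a := cos_sum h hh0.le N
  have e : h * N = k * (2 * Real.pi) := by rw [hh]; field_simp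
  rw [e, show Real.sin (k * (2 * Real.pi)) = 0 by have := Real.sin_nat_mul_pi (2*k); push_cast at this; rw [← this]; congr 1; ring] at a
  have b := (abs_le.1 a).1
  have : h * (-(2 * Real.pi * k)) ≤ h * ∑ i ∈ Finset.range N, Real.cos (h * i) := by nlinarith
  exact le_of_mul_le_mul_left this hh0

lemma uniq (c : ℕ → ℕ → ℝ)
    (hc : ∀ N, 2 ≤ N → ∀ x, 1 ≤ x → x ≤ N - 1 → 0 < c N x)
    (hLLN : LLN (fun N x => 1 / c N x)) (k : ℕ) :
    ∃ N₀ : ℕ, ∀ N ≥ N₀, ∀ v w, 0 ≤ v → 0 ≤ w → |v - Real.pi * k| ≤ 1/16 → |w - Real.pi * k| ≤ 1/16 →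
      (sol (fun k => 1 / c N (k+1)) N (v^2) N).2 = 0 → (sol (fun k => 1 / c N (k+1)) N (w^2) N).2 = 0 →
      v = w := by
  obtain ⟨N₁, h₁⟩ := approx c hc hLLN (Real.pi * k + 1) (1/16) (by norm_num)
  obtain ⟨N₂, h₂⟩ := exists_nat_ge (20 * (Real.pi * k))
  refine ⟨max N₁ N₂, fun N hN v w hv hw hvk hwk sv sw => ?_⟩
  obtain ⟨hN2, H⟩ := h₁ N (le_trans (le_max_left _ _) hN)
  have hNb : 20 * (Real.pi * k) ≤ N := h₂.trans (by exact_mod_cast (le_trans (le_max_right _ _) hN))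
  by_contra hvw
  have hne : v^2 ≠ w^2 := by
    intro h
    exact hvw ((pow_left_inj₀ hv hw (by norm_num)).1 h)
  have horth := sol_orth _ N (v^2) (w^2) (by omega) hne sv sw
  have hNp : (0:ℝ) < N := by positivity
  have hC : ∀ u, 0 ≤ u → |u - Real.pi * k| ≤ 1/16 → ∀ i, i < N →
      |(sol (fun k => 1 / c N (k+1)) N (u^2) i).1 - Real.cos (Real.pi * k / N * i)| ≤ 1/8 := by
    intro u hu huk i hi
    have a := (H u hu (by linarith [(abs_le.1 huk).2])).1 i hi
    have b := Real.abs_cos_sub_cos_le (u / N * i) (Real.pi * k / N * i)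
    have e : u / N * i - Real.pi * k / N * i = (u - Real.pi * k) * (i / N) := by ring
    have hi1 : (i:ℝ) / N ≤ 1 := by rw [div_le_one hNp]; exact_mod_cast hi.le
    have hi0 : (0:ℝ) ≤ i / N := by positivity
    rw [e, abs_mul, abs_of_nonneg hi0] at b
    have b2 : |u - Real.pi * k| * (i / N) ≤ 1/16 * 1 := by gcongr
    have := abs_sub_le (sol (fun k => 1 / c N (k+1)) N (u^2) i).1 (Real.cos (u / N * i)) (Real.cos (Real.pi * k / N * i))
    linarith
  have hlow : ∀ i ∈ Finset.range N, (15/64 : ℝ) + 1/2 * Real.cos (2 * Real.pi * k / N * i) ≤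
      (sol (fun k => 1 / c N (k+1)) N (v^2) i).1 * (sol (fun k => 1 / c N (k+1)) N (w^2) i).1 := by
    intro i hi
    rw [Finset.mem_range] at hi
    have a := abs_le.1 (hC v hv hvk i hi)
    have b := abs_le.1 (hC w hw hwk i hi)
    have e : 2 * Real.pi * k / N * i = 2 * (Real.pi * k / N * i) := by ring
    rw [e, Real.cos_two_mul]
    set C := Real.cos (Real.pi * k / N * i)
    have c1 : C ≤ 1 := Real.cos_le_one _
    have c2 : -1 ≤ C := Real.neg_one_le_cos _
    obtain ⟨x, hx⟩ : ∃ x, x = (sol (fun k => 1 / c N (k+1)) N (v^2) i).1 - C := ⟨_, rfl⟩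
    obtain ⟨y, hy⟩ : ∃ y, y = (sol (fun k => 1 / c N (k+1)) N (w^2) i).1 - C := ⟨_, rfl⟩
    rw [← hx] at a
    rw [← hy] at b
    have e1 : (sol (fun k => 1 / c N (k+1)) N (v^2) i).1 = C + x := by rw [hx]; ring
    have e2 : (sol (fun k => 1 / c N (k+1)) N (w^2) i).1 = C + y := by rw [hy]; ring
    rw [e1, e2]
    have p1 : |C * (x + y)| ≤ 1 * (1/4) := by
      rw [abs_mul]
      gcongr
      · exact abs_le.2 ⟨c2, c1⟩
      · rw [abs_le]; constructor <;> linarith [a.1, a.2, b.1, b.2]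
    have p2 : |x * y| ≤ 1/8 * (1/8) := by
      rw [abs_mul]
      gcongr
      · exact abs_le.2 a
      · exact abs_le.2 b
    have q1 := (abs_le.1 p1).1
    have q2 := (abs_le.1 p2).1
    nlinarith
  have hs := Finset.sum_le_sum hlow
  rw [horth, Finset.sum_add_distrib, ← Finset.mul_sum] at hs
  simp only [Finset.sum_const, Finset.card_range, nsmul_eq_mul] at hs
  have := cos_sum_ge k N (by omega)
  linarith

lemma sin_shift (k : ℕ) (x : ℝ) : Real.sin (Real.pi * k + x) = (-1)^k * Real.sin x := by
  rw [add_comm, mul_comm, Real.sin_add_nat_mul_pi]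

lemma exist (c : ℕ → ℕ → ℝ)
    (hc : ∀ N, 2 ≤ N → ∀ x, 1 ≤ x → x ≤ N - 1 → 0 < c N x)
    (hLLN : LLN (fun N x => 1 / c N x)) (k : ℕ) (hk : 1 ≤ k) (δ : ℝ) (hδ : 0 < δ) (hδ1 : δ ≤ 1) :
    ∃ N₀ : ℕ, ∀ N ≥ N₀, ∃ w, 0 ≤ w ∧ |w - Real.pi * k| ≤ δ ∧
      (sol (fun k => 1 / c N (k+1)) N (w^2) N).2 = 0 := by
  have hsin : 0 < Real.sin δ := Real.sin_pos_of_pos_of_lt_pi hδ (by linarith [Real.pi_gt_three])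
  obtain ⟨N₁, h₁⟩ := approx c hc hLLN (Real.pi * k + 1) (Real.sin δ) hsin
  refine ⟨N₁, fun N hN => ?_⟩
  obtain ⟨hN2, H⟩ := h₁ N hN
  have hNp : (0:ℝ) < N := by positivity
  have hk' : (1:ℝ) ≤ k := by exact_mod_cast hk
  have hpk : 3 ≤ Real.pi * k := by nlinarith [Real.pi_gt_three]
  set g : ℝ → ℝ := fun w => (-1)^k * (sol (fun k => 1 / c N (k+1)) N (w^2) N).2 with hg
  have hcont : Continuous g := by
    have := (sol_cont (fun k => 1 / c N (k+1)) N N).2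
    exact continuous_const.mul (this.comp (continuous_pow 2))
  have happ : ∀ x, -1 ≤ x → x ≤ 1 → |g (Real.pi * k + x) + (Real.pi * k + x) * Real.sin x| ≤ Real.sin δ := by
    intro x hx1 hx2
    have h := (H (Real.pi * k + x) (by linarith) (by linarith)).2 N le_rfl
    have e : (Real.pi * k + x) / N * N = Real.pi * k + x := by field_simp
    rw [e, sin_shift] at h
    have s1 : |((-1:ℝ))^k| = 1 := by simp
    have s2 : ((-1:ℝ))^k * (-1)^k = 1 := by rw [← mul_pow]; simp
    have e2 : g (Real.pi * k + x) + (Real.pi * k + x) * Real.sin x =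
      (-1)^k * ((sol (fun k => 1 / c N (k+1)) N ((Real.pi * k + x)^2) N).2 + (Real.pi * k + x) * ((-1)^k * Real.sin x)) := by
      simp only [hg]
      linear_combination (-(Real.pi * k + x) * Real.sin x) * s2
    rw [e2, abs_mul, s1, one_mul]
    exact h
  have a := (abs_le.1 (happ δ (by linarith) hδ1)).2
  have b := (abs_le.1 (happ (-δ) (by linarith) (by linarith))).1
  rw [Real.sin_neg] at b
  have a' : g (Real.pi * k + δ) ≤ 0 := by nlinarith
  have b' : 0 ≤ g (Real.pi * k + -δ) := by nlinarith
  obtain ⟨w, hw, hw0⟩ := intermediate_value_Icc' (by linarith : Real.pi * k + -δ ≤ Real.pi * k + δ)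
    hcont.continuousOn (show (0:ℝ) ∈ Set.Icc _ _ from ⟨a', b'⟩)
  refine ⟨w, by linarith [hw.1], ?_, ?_⟩
  · rw [abs_le]; constructor <;> linarith [hw.1, hw.2]
  · simp only [hg] at hw0
    exact (mul_eq_zero.1 hw0).resolve_left (by simp)

lemma locate (c : ℕ → ℕ → ℝ)
    (hc : ∀ N, 2 ≤ N → ∀ x, 1 ≤ x → x ≤ N - 1 → 0 < c N x)
    (hLLN : LLN (fun N x => 1 / c N x)) (k : ℕ) (δ : ℝ) (hδ : 0 < δ) (hδ1 : δ ≤ 1) :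
    ∃ N₀ : ℕ, ∀ N ≥ N₀, ∀ w, Real.pi * k + δ < w → w < Real.pi * (k+1) - δ →
      (sol (fun k => 1 / c N (k+1)) N (w^2) N).2 ≠ 0 := by
  have hsin : 0 < Real.sin δ := Real.sin_pos_of_pos_of_lt_pi hδ (by linarith [Real.pi_gt_three])
  obtain ⟨N₁, h₁⟩ := approx c hc hLLN (Real.pi * (k+1)) (δ * Real.sin δ / 2) (by positivity)
  refine ⟨N₁, fun N hN w hw1 hw2 h0 => ?_⟩
  obtain ⟨hN2, H⟩ := h₁ N hN
  have hNp : (0:ℝ) < N := by positivity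
  have hpk : 0 ≤ Real.pi * k := by positivity
  have h := (H w (by linarith) (by linarith)).2 N le_rfl
  have e : w / N * N = Real.pi * k + (w - Real.pi * k) := by field_simp; ring
  rw [e, sin_shift, h0, zero_add, abs_mul, abs_mul, abs_of_nonneg (by linarith : 0 ≤ w)] at h
  have s1 : |((-1:ℝ))^k| = 1 := by simp
  rw [s1, one_mul] at h
  set x := w - Real.pi * k with hx
  have hx1 : δ ≤ x := by linarith
  have hx2 : x ≤ Real.pi - δ := by rw [hx]; linarith
  have hs : Real.sin δ ≤ Real.sin x := by
    rcases le_total x (Real.pi / 2) with h | h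
    · exact Real.sin_le_sin_of_le_of_le_pi_div_two (by linarith [Real.pi_pos]) h hx1
    · rw [← Real.sin_pi_sub x]
      exact Real.sin_le_sin_of_le_of_le_pi_div_two (by linarith [Real.pi_pos]) (by linarith) (by linarith)
  rw [abs_of_nonneg (by linarith)] at h
  have : δ * Real.sin δ ≤ w * Real.sin x := by gcongr <;> linarith
  have : 0 < δ * Real.sin δ := by positivity
  linarith

lemma main_loc (c : ℕ → ℕ → ℝ) (lam : ℕ → ℕ → ℝ)
    (hc : ∀ N, 2 ≤ N → ∀ x, 1 ≤ x → x ≤ N - 1 → 0 < c N x)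
    (hLLN : LLN (fun N x => 1 / c N x))
    (hlam0 : ∀ N, 2 ≤ N → lam N 0 = 0)
    (hmono : ∀ N, 2 ≤ N → ∀ i j, i < j → j < N → lam N i < lam N j)
    (hchar : ∀ N, 2 ≤ N → ∀ μ : ℝ, IsEigenvalue N (c N) μ ↔ ∃ i < N, μ = lam N i)
    (j : ℕ) : ∀ δ : ℝ, 0 < δ → ∃ N₀ : ℕ, ∀ N ≥ N₀, |√((N:ℝ)^2 * lam N j) - Real.pi * j| ≤ δ := by
  induction j with
  | zero =>
    intro δ hδ
    refine ⟨2, fun N hN => ?_⟩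
    rw [hlam0 N hN]; simp [hδ.le]
  | succ k ih =>
    intro δ' hδ'
    set δ := min δ' (1/16) with hδdef
    have hδ : 0 < δ := by positivity
    have hδ1 : δ ≤ 1/16 := min_le_right _ _
    obtain ⟨N₁, h₁⟩ := ih δ hδ
    obtain ⟨N₂, h₂⟩ := uniq c hc hLLN k
    obtain ⟨N₃, h₃⟩ := exist c hc hLLN (k+1) (by omega) δ hδ (by linarith)
    obtain ⟨N₄, h₄⟩ := locate c hc hLLN k δ hδ (by linarith)
    refine ⟨N₁ + N₂ + N₃ + N₄ + k + 2, fun N hN => ?_⟩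
    have hN2 : 2 ≤ N := by omega
    have hNp : (0:ℝ) < N := by positivity
    have a₁ := h₁ N (by omega)
    obtain ⟨w, hw0, hwk, hws⟩ := h₃ N (by omega)
    have hnn : ∀ i, i < N → 0 ≤ lam N i := by
      intro i hi
      rcases Nat.eq_zero_or_pos i with rfl | h
      · rw [hlam0 N hN2]
      · rw [← hlam0 N hN2]; exact (hmono N hN2 0 i h hi).le
    have hroot : ∀ i, i < N → (sol (fun k => 1 / c N (k+1)) N ((√((N:ℝ)^2 * lam N i))^2) N).2 = 0 := by
      intro i hi
      have h0 := hnn i hi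
      rw [Real.sq_sqrt (by positivity)]
      exact (eig_iff N hN2 (c N) (hc N hN2) _).1 ((hchar N hN2 _).2 ⟨i, hi, rfl⟩)
    -- the eigenvalue found by the intermediate value theorem
    have hwe : IsEigenvalue N (c N) (w^2 / N^2) := by
      rw [eig_iff N hN2 (c N) (hc N hN2)]
      have : (N:ℝ)^2 * (w^2 / N^2) = w^2 := by field_simp
      rw [this]; exact hws
    obtain ⟨i, hiN, hi⟩ := (hchar N hN2 _).1 hwe
    have hwi : w = √((N:ℝ)^2 * lam N i) := by
      rw [← hi]
      have : (N:ℝ)^2 * (w^2 / N^2) = w^2 := by field_simp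
      rw [this, Real.sqrt_sq hw0]
    have hlt : ∀ p q, p < q → q < N → √((N:ℝ)^2 * lam N p) < √((N:ℝ)^2 * lam N q) := by
      intro p q hpq hq
      have := hmono N hN2 p q hpq hq
      have := hnn p (by omega)
      apply Real.sqrt_lt_sqrt (by positivity)
      gcongr
    push_cast at hwk ⊢
    have hki : k < i := by
      by_contra hcon
      have hle : w ≤ √((N:ℝ)^2 * lam N k) := by
        rcases Nat.lt_or_ge i k with h | h
        · rw [hwi]; exact (hlt i k h (by omega)).le
        · have : i = k := by omega
          rw [hwi, this]
      have := (abs_le.1 hwk).1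
      have := (abs_le.1 a₁).2
      nlinarith [Real.pi_gt_three]
    set v := √((N:ℝ)^2 * lam N (k+1)) with hv
    have hvk : √((N:ℝ)^2 * lam N k) < v := hlt k (k+1) (by omega) (by omega)
    have hvw : v ≤ w := by
      rw [hwi]
      rcases Nat.lt_or_ge (k+1) i with h | h
      · exact (hlt (k+1) i h hiN).le
      · have : i = k+1 := by omega
        rw [this]
    have hvr := hroot (k+1) (by omega)
    have hkr := hroot k (by omega)
    have hv0 : 0 ≤ v := Real.sqrt_nonneg _
    have hup : v ≤ Real.pi * (k+1) + δ := by linarith [(abs_le.1 hwk).2]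
    have hlo : Real.pi * (k+1) - δ ≤ v := by
      by_contra hcon
      push Not at hcon
      rcases lt_or_ge (Real.pi * k + δ) v with h | h
      · exact h₄ N (by omega) v h hcon hvr
      · have := h₂ N (by omega) _ v (Real.sqrt_nonneg _) hv0 (a₁.trans hδ1)
          (by rw [abs_le]; constructor <;> linarith [(abs_le.1 a₁).1]) hkr hvr
        linarith
    have hδδ : δ ≤ δ' := min_le_left _ _
    rw [abs_le]; constructor <;> linarith

/-- Under condition (LLN), for any fixed `j ≥ 1` the `j`-th eigenvalue `λ_j^{(N)}`
of `−Δ^{c^{(N)}}` satisfies `N²·λ_j^{(N)}/π² → j²`. -/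
theorem eigenvalue_asymptotics (c : ℕ → ℕ → ℝ) (lam : ℕ → ℕ → ℝ)
    (hc : ∀ N, 2 ≤ N → ∀ x, 1 ≤ x → x ≤ N - 1 → 0 < c N x)
    (hLLN : LLN (fun N x => 1 / c N x))
    (hlam0 : ∀ N, 2 ≤ N → lam N 0 = 0)
    (hmono : ∀ N, 2 ≤ N → ∀ i j, i < j → j < N → lam N i < lam N j)
    (hchar : ∀ N, 2 ≤ N → ∀ μ : ℝ, IsEigenvalue N (c N) μ ↔ ∃ i < N, μ = lam N i)
    (j : ℕ) (hj : 1 ≤ j) :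
    Tendsto (fun N : ℕ => (N : ℝ) ^ 2 * lam N j / Real.pi ^ 2)
      atTop (nhds ((j : ℝ) ^ 2)) := by
  have h := main_loc c lam hc hLLN hlam0 hmono hchar j
  have ht : Tendsto (fun N : ℕ => √((N:ℝ)^2 * lam N j)) atTop (nhds (Real.pi * j)) := by
    rw [Metric.tendsto_atTop]
    intro ε hε
    obtain ⟨N₀, h₀⟩ := h (ε/2) (by linarith)
    refine ⟨N₀, fun N hN => ?_⟩
    rw [Real.dist_eq]
    linarith [h₀ N hN]
  have ht2 := (ht.pow 2).div_const (Real.pi^2)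
  have e : (Real.pi * j)^2 / Real.pi^2 = (j:ℝ)^2 := by
    have := Real.pi_pos.ne'
    field_simp
  rw [e] at ht2
  refine ht2.congr' ?_
  filter_upwards [eventually_ge_atTop (j+2)] with N hN
  have h0 : 0 < lam N j := by
    rw [← hlam0 N (by omega)]
    exact hmono N (by omega) 0 j (by omega) (by omega)
  rw [Real.sq_sqrt (by positivity)]
end
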